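/- Assume the standing conditions on H, f, m₀, u_T, that 2 < γ' ≤ N+2 and α < γ'/N, and for each η ∈ (0,1] let (u_η, m_η) be a classical solution of the penalized MFG system such that (m_η, −m_η∇H_η(∇u_η)) minimises the penalized energy E_η over K. Then for every p ∈ [1, (N+2)/(N+2−γ')) (with the convention (N+2)/(N+2−γ') = +∞ when γ' = N+2) there exists C_p > 0, independent of η ∈ (0,1], such that ‖m_η‖_{L^p(Q)} ≤ C_p. -/

import Mathlib

open MeasureTheory Set Filter Topology

noncomputable section

/-- Points of `ℝ^N`.  `ℤ^N`-periodic functions on `RN N` model functions on the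
flat torus `T^N`. -/
abbrev RN (N : ℕ) := Fin N → ℝ

/-- The Euclidean norm on `ℝ^N`. -/
def euclNorm {N : ℕ} (p : RN N) : ℝ := Real.sqrt (∑ i, p i ^ 2)

/-- The Euclidean inner product on `ℝ^N`. -/
def dotp {N : ℕ} (p q : RN N) : ℝ := ∑ i, p i * q i

/-- `ℤ^N`-periodicity: such functions are exactly the functions on the flat torus `T^N`. -/
def ZPeriodic {N : ℕ} {β : Type*} (u : RN N → β) : Prop :=
  ∀ (x : RN N) (z : Fin N → ℤ), u (fun i => x i + (z i : ℝ)) = u x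

/-- Partial derivative in the `i`-th coordinate direction. -/
def pd {N : ℕ} (i : Fin N) (u : RN N → ℝ) (x : RN N) : ℝ := fderiv ℝ u x (Pi.single i 1)

/-- Spatial gradient. -/
def grad {N : ℕ} (u : RN N → ℝ) (x : RN N) : RN N := fun i => pd i u x

/-- Divergence of a vector field. -/
def dive {N : ℕ} (w : RN N → RN N) (x : RN N) : ℝ := ∑ i, pd i (fun y => w y i) x

/-- Laplacian. -/
def lap {N : ℕ} (u : RN N → ℝ) (x : RN N) : ℝ := ∑ i, pd i (pd i u) x

/-- The unit cube, a fundamental domain for the torus `T^N` (of total measure `1`,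
so that the measure on the torus is the normalized one). -/
def cube (N : ℕ) : Set (RN N) := Set.Icc 0 1

/-- The space-time cylinder `Q = T^N × (0,T)`. -/
def QQ (N : ℕ) (T : ℝ) : Set (RN N × ℝ) := cube N ×ˢ Ioo 0 T

/-- Integral over `Q = T^N × (0,T)`. -/
def intQ (N : ℕ) (T : ℝ) (f : RN N → ℝ → ℝ) : ℝ := ∫ q in QQ N T, f q.1 q.2

/-- Smooth space-periodic test functions on `T^N × [0,T]`. -/
def IsTest (N : ℕ) (φ : RN N → ℝ → ℝ) : Prop :=
  ContDiff ℝ (⊤ : ℕ∞) (fun q : RN N × ℝ => φ q.1 q.2) ∧ ∀ t, ZPeriodic fun x => φ x t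

/-- The Legendre transform `L(q) = sup_p (p·q - H(p))`. -/
def Leg {N : ℕ} (H : RN N → ℝ) (q : RN N) : ℝ := sSup ((fun p => dotp p q - H p) '' Set.univ)

/-- `m L(-w/m)`, with the convention that it vanishes when `m ≤ 0` (recall that in `K`
one has `w = 0` a.e. on `{m = 0}`). -/
def mLag {N : ℕ} (L : RN N → ℝ) (mv : ℝ) (wv : RN N) : ℝ :=
  if 0 < mv then mv * L ((-mv⁻¹) • wv) else 0

/-- `|w|^{γ'} m^{1-γ'}`, with the convention that it vanishes when `m ≤ 0`. -/
def kinQ {N : ℕ} (γ' : ℝ) (mv : ℝ) (wv : RN N) : ℝ :=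
  if 0 < mv then euclNorm wv ^ γ' * mv ^ (1 - γ') else 0

/-- `F(x,m) = ∫_0^m f(x,σ) dσ`. -/
def Fint {N : ℕ} (f : RN N → ℝ → ℝ) (x : RN N) (mv : ℝ) : ℝ := ∫ σ in (0:ℝ)..mv, f x σ

/-- The convexifying term `G(x,t,m)`, as a function of `m̄(x,t)` (argument `mb`) and `m`. -/
def Gcvx (c_f α mb mv : ℝ) : ℝ :=
  ((c_f + 1) / (α * (α + 1))) * ((mv + 1) ^ (α + 1) - (mb + 1) ^ (α + 1))
    - ((c_f + 1) / α) * (mb + 1) ^ α * (mv - mb)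

/-- `g = ∂_m G`, as a function of `m̄(x,t)` (argument `mb`) and `m`. -/
def gcvx (c_f α mb mv : ℝ) : ℝ := ((c_f + 1) / α) * ((mv + 1) ^ α - (mb + 1) ^ α)

/-- The penalised Lagrangian `L_η(q) = L(q) + (η/(N+3)) |q|^{N+3}`. -/
def Lpen {N : ℕ} (L : RN N → ℝ) (η : ℝ) (q : RN N) : ℝ :=
  L q + (η / ((N : ℝ) + 3)) * euclNorm q ^ ((N : ℝ) + 3)

/-- The penalised Hamiltonian `H_η`, the Legendre transform of `L_η`. -/
def Hpen {N : ℕ} (L : RN N → ℝ) (η : ℝ) : RN N → ℝ := Leg (Lpen L η)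

/-- `g` is the weak spatial gradient of `m` on `Q`. -/
def HasWeakGradQ (N : ℕ) (T : ℝ) (m : RN N → ℝ → ℝ) (g : RN N → ℝ → RN N) : Prop :=
  ∀ Φ : RN N → ℝ → RN N, ContDiff ℝ (⊤ : ℕ∞) (fun q : RN N × ℝ => Φ q.1 q.2) →
    (∀ t, ZPeriodic fun x => Φ x t) →
    intQ N T (fun x t => m x t * dive (fun y => Φ y t) x)
      = -intQ N T (fun x t => dotp (g x t) (Φ x t))

/-- `m` is `θ`-Hölder continuous on `T^N × [0,T]` with constant `C`. -/
def HolderOnQ (N : ℕ) (T C θ : ℝ) (m : RN N → ℝ → ℝ) : Prop :=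
  ∀ x t x' t', t ∈ Icc (0:ℝ) T → t' ∈ Icc (0:ℝ) T →
    |m x t - m x' t'| ≤
      C * Real.sqrt (euclNorm (fun i => x i - x' i) ^ 2 + (t - t') ^ 2) ^ θ

/-- Membership in the constraint set `K`: `(m,w) ∈ L^{α+1}(Q) × L¹(Q;ℝ^N)`, `m ≥ 0`,
`|w|^{γ'} m^{1-γ'} ∈ L¹(Q)`, together with the weak Fokker–Planck constraint
(with initial datum `m₀`); the field `traceId` states that `m(·,T)` is the time-`T`
trace of `m` determined by the constraint. -/
structure MemK (N : ℕ) (T α γ' : ℝ) (m₀ : RN N → ℝ)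
    (m : RN N → ℝ → ℝ) (w : RN N → ℝ → RN N) : Prop where
  per_m : ∀ t, ZPeriodic fun x => m x t
  per_w : ∀ t, ZPeriodic fun x => w x t
  nonneg : ∀ x t, 0 ≤ m x t
  lp_m : IntegrableOn (fun q : RN N × ℝ => m q.1 q.2 ^ (α + 1)) (QQ N T)
  l1_w : IntegrableOn (fun q : RN N × ℝ => w q.1 q.2) (QQ N T)
  vanish : ∀ᵐ q ∂(volume.restrict (QQ N T)), m q.1 q.2 = 0 → w q.1 q.2 = 0
  kin_int : IntegrableOn (fun q : RN N × ℝ => kinQ γ' (m q.1 q.2) (w q.1 q.2)) (QQ N T)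
  traceInt : IntegrableOn (fun x => m x T) (cube N)
  fp : ∀ φ : RN N → ℝ → ℝ, IsTest N φ → (∀ x, φ x T = 0) →
    intQ N T (fun x t => m x t * deriv (φ x) t + dotp (w x t) (grad (fun y => φ y t) x)
        + m x t * lap (fun y => φ y t) x)
      + (∫ x in cube N, m₀ x * φ x 0) = 0
  traceId : ∀ φ : RN N → ℝ → ℝ, IsTest N φ →
    intQ N T (fun x t => m x t * deriv (φ x) t + dotp (w x t) (grad (fun y => φ y t) x)
        + m x t * lap (fun y => φ y t) x)
      + (∫ x in cube N, m₀ x * φ x 0) - (∫ x in cube N, m x T * φ x T) = 0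

/-- The energy functional `E` on `K`, with Lagrangian `L` and coupling antiderivative `F`. -/
def energyF (N : ℕ) (T : ℝ) (L : RN N → ℝ) (F : RN N → ℝ → ℝ) (uT : RN N → ℝ)
    (m : RN N → ℝ → ℝ) (w : RN N → ℝ → RN N) : ℝ :=
  intQ N T (fun x t => mLag L (m x t) (w x t) - F x (m x t)) + ∫ x in cube N, uT x * m x T

/-- `(m,w)` belongs to `K` and minimises the energy over `K`. -/
def MinimisesE (N : ℕ) (T α γ' : ℝ) (m₀ : RN N → ℝ) (L : RN N → ℝ) (F : RN N → ℝ → ℝ)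
    (uT : RN N → ℝ) (m : RN N → ℝ → ℝ) (w : RN N → ℝ → RN N) : Prop :=
  MemK N T α γ' m₀ m w ∧
    ∀ m' w', MemK N T α γ' m₀ m' w' → energyF N T L F uT m w ≤ energyF N T L F uT m' w'

/-- Classical solution of the MFG system `-∂_t u - Δu + H(∇u) = fc(x,t,m)`,
`∂_t m - Δm - div(∇H(∇u) m) = 0`, `m(·,0) = m₀`, `u(·,T) = u_T`:
`u, m` are continuous on `T^N × [0,T]` together with `∂_t u, ∂_t m` and all first and
second space derivatives, and the equations hold pointwise. -/
structure ClassicalSol (N : ℕ) (T : ℝ) (H : RN N → ℝ) (fc : RN N → ℝ → ℝ → ℝ)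
    (m₀ uT : RN N → ℝ) (u m : RN N → ℝ → ℝ) : Prop where
  per_u : ∀ t, ZPeriodic fun x => u x t
  per_m : ∀ t, ZPeriodic fun x => m x t
  cont_u : ContinuousOn (fun q : RN N × ℝ => u q.1 q.2) ((Set.univ : Set (RN N)) ×ˢ Icc 0 T)
  cont_m : ContinuousOn (fun q : RN N × ℝ => m q.1 q.2) ((Set.univ : Set (RN N)) ×ˢ Icc 0 T)
  cont_ut : ContinuousOn (fun q : RN N × ℝ => deriv (u q.1) q.2)
    ((Set.univ : Set (RN N)) ×ˢ Icc 0 T)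
  cont_mt : ContinuousOn (fun q : RN N × ℝ => deriv (m q.1) q.2)
    ((Set.univ : Set (RN N)) ×ˢ Icc 0 T)
  cont_du : ∀ i, ContinuousOn (fun q : RN N × ℝ => pd i (fun y => u y q.2) q.1)
    ((Set.univ : Set (RN N)) ×ˢ Icc 0 T)
  cont_dm : ∀ i, ContinuousOn (fun q : RN N × ℝ => pd i (fun y => m y q.2) q.1)
    ((Set.univ : Set (RN N)) ×ˢ Icc 0 T)
  cont_ddu : ∀ i j, ContinuousOn (fun q : RN N × ℝ => pd i (pd j fun y => u y q.2) q.1)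
    ((Set.univ : Set (RN N)) ×ˢ Icc 0 T)
  cont_ddm : ∀ i j, ContinuousOn (fun q : RN N × ℝ => pd i (pd j fun y => m y q.2) q.1)
    ((Set.univ : Set (RN N)) ×ˢ Icc 0 T)
  tdiff_u : ∀ x, ∀ t ∈ Ioo 0 T, DifferentiableAt ℝ (u x) t
  tdiff_m : ∀ x, ∀ t ∈ Ioo 0 T, DifferentiableAt ℝ (m x) t
  xdiff_u : ∀ t ∈ Icc 0 T,
    Differentiable ℝ (fun y => u y t) ∧ ∀ i, Differentiable ℝ (pd i fun y => u y t)
  xdiff_m : ∀ t ∈ Icc 0 T,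
    Differentiable ℝ (fun y => m y t) ∧ ∀ i, Differentiable ℝ (pd i fun y => m y t)
  hjb : ∀ x, ∀ t ∈ Ioo 0 T,
    -deriv (u x) t - lap (fun y => u y t) x + H (grad (fun y => u y t) x) = fc x t (m x t)
  fkp : ∀ x, ∀ t ∈ Ioo 0 T,
    deriv (m x) t - lap (fun y => m y t) x
      - dive (fun y => m y t • grad H (grad (fun z => u z t) y)) x = 0
  init : ∀ x, m x 0 = m₀ x
  final : ∀ x, u x T = uT x

/-- Weak solution `(u,m)` (with weak spatial gradient `Du` of `u`) of the MFG system
`-∂_t u - Δu + H(∇u) = fc(x,t,m)`, `∂_t m - Δm - div(∇H(∇u) m) = 0`, `m(·,0) = m₀`,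
`u(·,T) = u_T`, in the sense of Definition 3.1 of the paper. -/
structure WeakSol (N : ℕ) (T γ α : ℝ) (H : RN N → ℝ) (fc : RN N → ℝ → ℝ → ℝ)
    (m₀ uT : RN N → ℝ) (u m : RN N → ℝ → ℝ) (Du : RN N → ℝ → RN N) : Prop where
  per_u : ∀ t, ZPeriodic fun x => u x t
  per_m : ∀ t, ZPeriodic fun x => m x t
  per_Du : ∀ t, ZPeriodic fun x => Du x t
  nonneg_m : ∀ x t, 0 ≤ m x t
  lp_m : IntegrableOn (fun q : RN N × ℝ => m q.1 q.2 ^ (α + 1)) (QQ N T)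
  lq_u_sup : α < γ / N → ∃ C, ∀ᵐ q ∂(volume.restrict (QQ N T)), |u q.1 q.2| ≤ C
  lq_u_int : γ / N < α →
    IntegrableOn (fun q : RN N × ℝ =>
      |u q.1 q.2| ^ (γ * (α + 1) * (1 + (N : ℝ)) / (α * N - γ))) (QQ N T)
  weak_grad : HasWeakGradQ N T u Du
  lγ_Du : IntegrableOn (fun q : RN N × ℝ => euclNorm (Du q.1 q.2) ^ γ) (QQ N T)
  int_mL : IntegrableOn (fun q : RN N × ℝ =>
      m q.1 q.2 * Leg H (grad H (Du q.1 q.2))) (QQ N T)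
  int_mDH : IntegrableOn (fun q : RN N × ℝ => m q.1 q.2 • grad H (Du q.1 q.2)) (QQ N T)
  hjb : ∀ φ : RN N → ℝ → ℝ, IsTest N φ → (∀ x t, 0 ≤ φ x t) →
    (∃ ε > (0:ℝ), ∀ x, ∀ t ≤ ε, φ x t = 0) →
    intQ N T (fun x t => u x t * deriv (φ x) t - u x t * lap (fun y => φ y t) x
        + (H (Du x t) - fc x t (m x t)) * φ x t)
      ≤ ∫ x in cube N, uT x * φ x T
  fkp : ∀ φ : RN N → ℝ → ℝ, IsTest N φ → (∀ x, φ x T = 0) →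
    intQ N T (fun x t => m x t * deriv (φ x) t
        - dotp (m x t • grad H (Du x t)) (grad (fun y => φ y t) x)
        + m x t * lap (fun y => φ y t) x)
      + (∫ x in cube N, m₀ x * φ x 0) = 0
  energy_id : intQ N T (fun x t =>
        m x t * (-(fc x t (m x t)) + Leg H (grad H (Du x t))))
      + (∫ x in cube N, (m x T * uT x - m₀ x * u x 0)) = 0

/-- Nonnegative weak solution of the Fokker–Planck equation
`∂_t m - Δm + div(A m) = 0` in `Q`, `m(·,0) = m₀`, with finite energy
`E = ∫_Q |A|^{γ'} m < ∞`. -/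
structure FPSol (N : ℕ) (T γ' : ℝ) (m₀ : RN N → ℝ) (m : RN N → ℝ → ℝ)
    (A : RN N → ℝ → RN N) : Prop where
  per_m : ∀ t, ZPeriodic fun x => m x t
  per_A : ∀ t, ZPeriodic fun x => A x t
  nonneg : ∀ x t, 0 ≤ m x t
  int_m : IntegrableOn (fun q : RN N × ℝ => m q.1 q.2) (QQ N T)
  int_E : IntegrableOn (fun q : RN N × ℝ => euclNorm (A q.1 q.2) ^ γ' * m q.1 q.2) (QQ N T)
  weak : ∀ φ : RN N → ℝ → ℝ, IsTest N φ → (∀ x, φ x T = 0) →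
    intQ N T (fun x t => m x t * (deriv (φ x) t + lap (fun y => φ y t) x
        + dotp (A x t) (grad (fun y => φ y t) x)))
      + (∫ x in cube N, m₀ x * φ x 0) = 0

/-- Conditions on the initial datum of the Fokker–Planck equation: a periodic (i.e.
defined on the torus) Lipschitz probability density, with `‖∇m₀‖_∞ ≤ K₀`. -/
def FPData (N : ℕ) (K₀ : ℝ) (m₀ : RN N → ℝ) : Prop :=
  ZPeriodic m₀ ∧ (∀ x, 0 ≤ m₀ x) ∧ (∫ x in cube N, m₀ x) = 1 ∧
    Differentiable ℝ m₀ ∧ ∀ x, euclNorm (grad m₀ x) ≤ K₀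

lemma dotp_add_left {N : ℕ} (p q r : RN N) : dotp (p + q) r = dotp p r + dotp q r := by
  simp [dotp, add_mul, Finset.sum_add_distrib]

lemma dotp_add_right {N : ℕ} (p q r : RN N) : dotp p (q + r) = dotp p q + dotp p r := by
  simp [dotp, mul_add, Finset.sum_add_distrib]

lemma dotp_sub_left {N : ℕ} (p q r : RN N) : dotp (p - q) r = dotp p r - dotp q r := by
  simp [dotp, sub_mul, Finset.sum_sub_distrib]

lemma dotp_sub_right {N : ℕ} (p q r : RN N) : dotp p (q - r) = dotp p q - dotp p r := by
  simp [dotp, mul_sub, Finset.sum_sub_distrib]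

lemma dotp_smul_left {N : ℕ} (c : ℝ) (p q : RN N) : dotp (c • p) q = c * dotp p q := by
  simp [dotp, Finset.mul_sum, mul_assoc]

lemma dotp_smul_right {N : ℕ} (c : ℝ) (p q : RN N) : dotp p (c • q) = c * dotp p q := by
  simp only [dotp, Finset.mul_sum, Pi.smul_apply, smul_eq_mul]
  exact Finset.sum_congr rfl fun i _ => by ring

lemma dotp_comm {N : ℕ} (p q : RN N) : dotp p q = dotp q p := by
  simp [dotp, mul_comm]

lemma dotp_self_nonneg {N : ℕ} (p : RN N) : 0 ≤ dotp p p :=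
  Finset.sum_nonneg fun i _ => mul_self_nonneg (p i)

lemma dotp_self_eq_zero {N : ℕ} {p : RN N} (h : dotp p p = 0) : p = 0 := by
  funext i
  have := (Finset.sum_eq_zero_iff_of_nonneg fun i _ => mul_self_nonneg (p i)).1 h i
    (Finset.mem_univ i)
  simpa using this

lemma euclNorm_sq {N : ℕ} (p : RN N) : euclNorm p ^ 2 = dotp p p := by
  rw [euclNorm, Real.sq_sqrt (Finset.sum_nonneg fun _ _ => sq_nonneg _)]
  simp [dotp, sq]

lemma euclNorm_nonneg {N : ℕ} (p : RN N) : 0 ≤ euclNorm p := Real.sqrt_nonneg _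

lemma dotp_le_euclNorm {N : ℕ} (p q : RN N) : dotp p q ≤ euclNorm p * euclNorm q :=
  Real.sum_mul_le_sqrt_mul_sqrt _ _ _

lemma abs_apply_le_euclNorm {N : ℕ} (p : RN N) (i : Fin N) : |p i| ≤ euclNorm p :=
  Real.abs_le_sqrt (Finset.single_le_sum (f := fun i => p i ^ 2)
    (fun _ _ => sq_nonneg _) (Finset.mem_univ i))

lemma norm_le_euclNorm {N : ℕ} (p : RN N) : ‖p‖ ≤ euclNorm p :=
  (pi_norm_le_iff_of_nonneg (euclNorm_nonneg p)).2 fun i => abs_apply_le_euclNorm p i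

@[fun_prop]
lemma continuous_dotp {N : ℕ} : Continuous fun x : RN N × RN N => dotp x.1 x.2 := by
  simp only [dotp]; fun_prop

@[fun_prop]
lemma continuous_euclNorm {N : ℕ} : Continuous (euclNorm : RN N → ℝ) := by
  unfold euclNorm; fun_prop

lemma fderiv_eq_dotp_grad {N : ℕ} (u : RN N → ℝ) (x v : RN N) :
    fderiv ℝ u x v = dotp (grad u x) v := by
  rw [dotp]
  conv_lhs => rw [← LinearMap.sum_single_apply (fun _ => ℝ) v, map_sum]
  refine Finset.sum_congr rfl fun i _ => ?_
  have : Pi.single i (v i) = v i • (Pi.single i (1 : ℝ) : RN N) := by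
    rw [← Pi.single_smul]; simp
  rw [this, map_smul, smul_eq_mul, mul_comm]
  rfl

lemma contDiff_grad {N : ℕ} {u : RN N → ℝ} {n m : WithTop ℕ∞} (hu : ContDiff ℝ n u)
    (h : m + 1 ≤ n) : ContDiff ℝ m (grad u) :=
  contDiff_pi.2 fun _ => (hu.fderiv_right h).clm_apply contDiff_const

/-! ### Convex functions -/

lemma ConvexOn.add_dotp_grad_le {N : ℕ} {H : RN N → ℝ} (hc : ConvexOn ℝ univ H) {x : RN N}
    (hd : DifferentiableAt ℝ H x) (y : RN N) : H x + dotp (grad H x) (y - x) ≤ H y := by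
  have hline : HasDerivAt (fun s : ℝ => H (x + s • (y - x))) (dotp (grad H x) (y - x)) 0 := by
    rw [← fderiv_eq_dotp_grad]
    have h1 : HasDerivAt (fun s : ℝ => x + s • (y - x)) (y - x) 0 := by
      simpa using ((hasDerivAt_id (0 : ℝ)).smul_const (y - x)).const_add x
    have h2 : HasFDerivAt H (fderiv ℝ H x) (x + (0 : ℝ) • (y - x)) := by
      simpa using hd.hasFDerivAt
    exact h2.comp_hasDerivAt 0 h1
  have hlim := hline.tendsto_slope_zero_right
  simp only [zero_add, zero_smul, add_zero, smul_eq_mul] at hlim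
  have hle : ∀ᶠ s in 𝓝[>] (0 : ℝ), s⁻¹ * (H (x + s • (y - x)) - H x) ≤ H y - H x := by
    filter_upwards [Ioo_mem_nhdsGT (zero_lt_one : (0 : ℝ) < 1)] with s hs
    have := hc.2 (mem_univ x) (mem_univ y) (sub_nonneg.2 hs.2.le) hs.1.le (by ring)
    have he : (1 - s) • x + s • y = x + s • (y - x) := by
      rw [sub_smul, smul_sub, one_smul]; abel
    rw [he, smul_eq_mul, smul_eq_mul] at this
    rw [inv_mul_le_iff₀ hs.1]
    linarith
  linarith [le_of_tendsto hlim hle]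

lemma ConvexOn.dotp_fderiv_grad_nonneg {N : ℕ} {H : RN N → ℝ} (hc : ConvexOn ℝ univ H)
    (hH : ContDiff ℝ 2 H) (x v : RN N) : 0 ≤ dotp (fderiv ℝ (grad H) x v) v := by
  have hd : Differentiable ℝ H := hH.differentiable (by norm_num)
  have hg : Differentiable ℝ (grad H) :=
    (contDiff_grad (m := 1) hH (by norm_num)).differentiable (by norm_num)
  have h1 : HasDerivAt (fun s : ℝ => x + s • v) v 0 := by
    simpa using ((hasDerivAt_id (0 : ℝ)).smul_const v).const_add x
  have h2 : HasFDerivAt (grad H) (fderiv ℝ (grad H) x) (x + (0 : ℝ) • v) := by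
    simpa using (hg x).hasFDerivAt
  have hlim := (h2.comp_hasDerivAt 0 h1).tendsto_slope_zero_right
  simp only [Function.comp_apply, zero_add, zero_smul, add_zero] at hlim
  have hlim2 : Tendsto (fun s : ℝ => dotp (s⁻¹ • (grad H (x + s • v) - grad H x)) v) (𝓝[>] 0)
      (𝓝 (dotp (fderiv ℝ (grad H) x v) v)) :=
    ((by fun_prop : Continuous fun y : RN N => dotp y v).tendsto _).comp hlim
  refine ge_of_tendsto hlim2 ?_
  filter_upwards [self_mem_nhdsWithin] with s (hs : 0 < s)
  have ha := hc.add_dotp_grad_le (hd x) (x + s • v)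
  have hb := hc.add_dotp_grad_le (hd (x + s • v)) x
  have e1 : x + s • v - x = s • v := by abel
  have e2 : x - (x + s • v) = (-s) • v := by rw [neg_smul]; abel
  rw [e1, dotp_smul_right] at ha
  rw [e2, dotp_smul_right] at hb
  rw [dotp_smul_left, dotp_sub_left]
  refine mul_nonneg (inv_nonneg.2 hs.le) ?_
  have : 0 ≤ s * (dotp (grad H (x + s • v)) v - dotp (grad H x) v) := by linarith
  exact nonneg_of_mul_nonneg_right this hs

lemma dotp_fderiv_grad_symm {N : ℕ} {H : RN N → ℝ} (hH : ContDiff ℝ 2 H) (x v w : RN N) :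
    dotp (fderiv ℝ (grad H) x v) w = dotp (fderiv ℝ (grad H) x w) v := by
  have hg : Differentiable ℝ (grad H) :=
    (contDiff_grad (m := 1) hH (by norm_num)).differentiable (by norm_num)
  have hf : Differentiable ℝ (fderiv ℝ H) :=
    (hH.fderiv_right (m := 1) (by norm_num)).differentiable (by norm_num)
  have key : ∀ v w, dotp (fderiv ℝ (grad H) x v) w = fderiv ℝ (fderiv ℝ H) x v w := by
    intro v w
    have e : (fun y => fderiv ℝ H y w) = fun y => dotp (grad H y) w :=
      funext fun y => fderiv_eq_dotp_grad H y w
    have h1 : HasFDerivAt (fun y => fderiv ℝ H y w)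
        ((fderiv ℝ (fderiv ℝ H) x).flip w) x := by
      simpa using (hf x).hasFDerivAt.clm_apply (hasFDerivAt_const w x)
    have h2 : HasFDerivAt (fun y => dotp (grad H y) w)
        (∑ i, w i • (ContinuousLinearMap.proj i).comp (fderiv ℝ (grad H) x)) x := by
      unfold dotp
      refine HasFDerivAt.fun_sum fun i _ => ?_
      exact (((ContinuousLinearMap.proj (R := ℝ) (φ := fun _ : Fin N => ℝ) i).hasFDerivAt.comp x
        (hg x).hasFDerivAt)).mul_const (w i)
    rw [e] at h1
    have := congrArg (fun T => T v) (h2.unique h1)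
    simp only [ContinuousLinearMap.flip_apply] at this
    rw [← this]
    simp [dotp, mul_comm]
  rw [key, key]
  exact second_derivative_symmetric (fun y => (hH.differentiable (by norm_num) y).hasFDerivAt)
    (hf x).hasFDerivAt v w

/-! ### Legendre transforms -/

lemma dotp_sub_le_Leg {N : ℕ} {H : RN N → ℝ} {q : RN N}
    (hb : BddAbove (range fun p => dotp p q - H p)) (p : RN N) : dotp p q - H p ≤ Leg H q := by
  rw [Leg, image_univ]
  exact le_csSup hb ⟨p, rfl⟩

lemma Leg_eq_of_forall_le {N : ℕ} {H : RN N → ℝ} {p q : RN N}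
    (h : ∀ p', dotp p' q - H p' ≤ dotp p q - H p) : Leg H q = dotp p q - H p := by
  rw [Leg, image_univ]
  exact IsGreatest.csSup_eq ⟨⟨p, rfl⟩, by rintro _ ⟨p', rfl⟩; exact h p'⟩

lemma Leg_grad {N : ℕ} {H : RN N → ℝ} (hc : ConvexOn ℝ univ H) (hd : Differentiable ℝ H)
    (r : RN N) : Leg H (grad H r) = dotp r (grad H r) - H r := by
  refine Leg_eq_of_forall_le fun r' => ?_
  have := hc.add_dotp_grad_le (hd r) r'
  rw [dotp_sub_right, dotp_comm _ r', dotp_comm _ r] at this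
  linarith

lemma convexOn_Leg {N : ℕ} {H : RN N → ℝ}
    (hb : ∀ q, BddAbove (range fun p => dotp p q - H p)) : ConvexOn ℝ univ (Leg H) := by
  refine ⟨convex_univ, fun x _ y _ a b ha hb' hab => ?_⟩
  conv_lhs => rw [Leg, image_univ]
  refine csSup_le (range_nonempty _) ?_
  rintro _ ⟨p, rfl⟩
  have h1 := mul_le_mul_of_nonneg_left (dotp_sub_le_Leg (hb x) p) ha
  have h2 := mul_le_mul_of_nonneg_left (dotp_sub_le_Leg (hb y) p) hb'
  simp only [dotp_add_right, dotp_smul_right, smul_eq_mul]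
  have : H p = a * H p + b * H p := by rw [← add_mul, hab, one_mul]
  linarith

lemma IsLocalMin.grad_eq_of_sub_dotp {N : ℕ} {h : RN N → ℝ} {p q : RN N}
    (hd : DifferentiableAt ℝ h p) (hm : ∀ p', h p - dotp p q ≤ h p' - dotp p' q) :
    grad h p = q := by
  have hlin : HasFDerivAt (fun p' : RN N => dotp p' q)
      (∑ i, q i • (ContinuousLinearMap.proj (R := ℝ) (φ := fun _ : Fin N => ℝ) i)) p := by
    unfold dotp
    exact HasFDerivAt.fun_sum fun i _ =>
      ((ContinuousLinearMap.proj (R := ℝ) (φ := fun _ : Fin N => ℝ) i).hasFDerivAt).mul_const (q i)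
  have hmin : IsLocalMin (fun p' => h p' - dotp p' q) p := Filter.Eventually.of_forall hm
  have h0 := hmin.hasFDerivAt_eq_zero (hd.hasFDerivAt.sub hlin)
  funext i
  have h1 := congrArg (fun T => T (Pi.single i 1)) (sub_eq_zero.1 h0)
  simp only [_root_.sum_apply, _root_.smul_apply,
    ContinuousLinearMap.proj_apply, Pi.single_apply, smul_eq_mul, mul_ite, mul_one, mul_zero,
    Finset.sum_ite_eq', Finset.mem_univ, if_true] at h1
  exact h1

/-- If `q` maximises `q ↦ p · q - L(q) - ψ(q)` with `L` convex and `ψ` differentiable, then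
`p - ∇ψ(q)` is a subgradient of `L` at `q`. -/
lemma ConvexOn.subgradient_of_isMax_sub {N : ℕ} {L ψ : RN N → ℝ} (hL : ConvexOn ℝ univ L)
    {p q : RN N} (hd : DifferentiableAt ℝ ψ q)
    (hq : ∀ q', dotp p q' - (L q' + ψ q') ≤ dotp p q - (L q + ψ q)) (q' : RN N) :
    dotp (p - grad ψ q) (q' - q) ≤ L q' - L q := by
  have hline : HasDerivAt (fun s : ℝ => ψ (q + s • (q' - q))) (dotp (grad ψ q) (q' - q)) 0 := by
    rw [← fderiv_eq_dotp_grad]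
    have h1 : HasDerivAt (fun s : ℝ => q + s • (q' - q)) (q' - q) 0 := by
      simpa using ((hasDerivAt_id (0 : ℝ)).smul_const (q' - q)).const_add q
    have h2 : HasFDerivAt ψ (fderiv ℝ ψ q) (q + (0 : ℝ) • (q' - q)) := by
      simpa using hd.hasFDerivAt
    exact h2.comp_hasDerivAt 0 h1
  have hlim := hline.tendsto_slope_zero_right
  simp only [zero_add, zero_smul, add_zero, smul_eq_mul] at hlim
  have hle : ∀ᶠ s in 𝓝[>] (0 : ℝ),
      dotp p (q' - q) - (L q' - L q) ≤ s⁻¹ * (ψ (q + s • (q' - q)) - ψ q) := by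
    filter_upwards [Ioo_mem_nhdsGT (zero_lt_one : (0 : ℝ) < 1)] with s hs
    have := hL.2 (mem_univ q) (mem_univ q') (sub_nonneg.2 hs.2.le) hs.1.le (by ring)
    have he : (1 - s) • q + s • q' = q + s • (q' - q) := by
      rw [sub_smul, smul_sub, one_smul]; abel
    rw [he, smul_eq_mul, smul_eq_mul] at this
    have h3 := hq (q + s • (q' - q))
    rw [dotp_add_right, dotp_smul_right] at h3
    rw [le_inv_mul_iff₀ hs.1]
    linarith
  rw [dotp_sub_left]
  linarith [ge_of_tendsto hlim hle]

lemma grad_eq_of_isSubgradient_Leg {N : ℕ} {H : RN N → ℝ} (hc : ConvexOn ℝ univ H)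
    (hd : Differentiable ℝ H) (hb : ∀ q, BddAbove (range fun p => dotp p q - H p))
    {r q : RN N} (h : ∀ q', dotp r (q' - q) ≤ Leg H q' - Leg H q) : grad H r = q := by
  refine IsLocalMin.grad_eq_of_sub_dotp (hd r) fun r' => ?_
  have h1 := h (grad H r)
  rw [Leg_grad hc hd, dotp_sub_right] at h1
  linarith [dotp_sub_le_Leg (hb q) r']

lemma eq_zero_of_add_comp_eq_zero {N : ℕ} {A B : RN N →L[ℝ] RN N}
    (hA : ∀ v, 0 ≤ dotp (A v) v) (hB : ∀ v, 0 ≤ dotp (B v) v)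
    (hs : ∀ v w, dotp (B v) w = dotp (B w) v) {v : RN N} (hv : v + A (B v) = 0) : v = 0 := by
  have h1 : dotp (B v) v + dotp (A (B v)) (B v) = 0 := by
    rw [dotp_comm (B v) v, ← dotp_add_left, hv]; simp [dotp]
  have h2 : dotp (B v) v = 0 := by linarith [hA (B v), hB v]
  have h3 : dotp (B v) (B v) = 0 := by
    by_contra hne
    have hpos : 0 < dotp (B v) (B v) := lt_of_le_of_ne (dotp_self_nonneg _) (Ne.symm hne)
    set a := dotp (B v) (B v)
    set b := dotp (B (B v)) (B v)
    have hb : 0 ≤ b := hB (B v)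
    have key : ∀ s : ℝ, 0 ≤ 2 * s * a + s ^ 2 * b := by
      intro s
      have := hB (v + s • B v)
      simp only [map_add, map_smul, dotp_add_left, dotp_add_right, dotp_smul_left,
        dotp_smul_right, h2, hs (B v) v] at this
      change 0 ≤ _ at this
      nlinarith
    have := key (-(a / (b + 1)))
    have hb1 : 0 < b + 1 := by linarith
    have e : 2 * -(a / (b + 1)) * a + (-(a / (b + 1))) ^ 2 * b
        = -(a ^ 2 * (b + 2)) / (b + 1) ^ 2 := by field_simp; ring
    rw [e] at this
    have : 0 < (a ^ 2 * (b + 2)) / (b + 1) ^ 2 := by positivity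
    have e2 := neg_div ((b + 1) ^ 2) (a ^ 2 * (b + 2))
    linarith
  have h4 := dotp_self_eq_zero h3
  simpa [h4] using hv

/-- The Legendre transform of `H^* + ψ` has a differentiable gradient if `H` and `ψ` are convex
and of class `C²`. -/
lemma differentiable_grad_Leg_add {N : ℕ} {H ψ : RN N → ℝ} (hc : ConvexOn ℝ univ H)
    (hH : ContDiff ℝ 2 H) (hψc : ConvexOn ℝ univ ψ) (hψ : ContDiff ℝ 2 ψ)
    (hb : ∀ q, BddAbove (range fun p => dotp p q - H p))
    (hmax : ∀ p, ∃ q, ∀ q', dotp p q' - (Leg H q' + ψ q') ≤ dotp p q - (Leg H q + ψ q)) :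
    Differentiable ℝ (grad (Leg fun q => Leg H q + ψ q)) := by
  have hd : Differentiable ℝ H := hH.differentiable (by norm_num)
  have hψd : Differentiable ℝ ψ := hψ.differentiable (by norm_num)
  have hG : ContDiff ℝ 1 (grad H) := contDiff_grad hH (by norm_num)
  have hP : ContDiff ℝ 1 (grad ψ) := contDiff_grad hψ (by norm_num)
  have hGd : Differentiable ℝ (grad H) := hG.differentiable (by norm_num)
  have hPd : Differentiable ℝ (grad ψ) := hP.differentiable (by norm_num)
  set S : RN N → RN N := fun r => r + grad ψ (grad H r) with hS
  set K : RN N → ℝ := fun r => dotp (S r) (grad H r)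
    - ((dotp r (grad H r) - H r) + ψ (grad H r)) with hK
  set Hη := Leg fun q => Leg H q + ψ q with hHη
  have hmaxS : ∀ r q', dotp (S r) q' - (Leg H q' + ψ q') ≤ K r := by
    intro r q'
    have h1 := dotp_sub_le_Leg (hb q') r
    have h2 := hψc.add_dotp_grad_le (hψd (grad H r)) q'
    simp only [hK, hS, dotp_add_left]
    rw [dotp_sub_right] at h2
    linarith
  have hHS : ∀ r, Hη (S r) = K r := by
    intro r
    have h1 : ∀ q', dotp q' (S r) - (Leg H q' + ψ q')
        ≤ dotp (grad H r) (S r) - (Leg H (grad H r) + ψ (grad H r)) := by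
      intro q'
      rw [dotp_comm, dotp_comm (grad H r), Leg_grad hc hd]
      exact hmaxS r q'
    rw [hHη, Leg_eq_of_forall_le h1, dotp_comm, Leg_grad hc hd]
  have hbη : ∀ r q', dotp (S r) q' - (Leg H q' + ψ q') ≤ Hη (S r) := fun r q' =>
    (hmaxS r q').trans (hHS r).ge
  have hsurj : ∀ p, ∃ r, S r = p := by
    intro p
    obtain ⟨q, hq⟩ := hmax p
    refine ⟨p - grad ψ q, ?_⟩
    have h1 := (convexOn_Leg hb).subgradient_of_isMax_sub (hψd q) hq
    have h2 := grad_eq_of_isSubgradient_Leg hc hd hb h1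
    simp only [hS, h2]; abel
  have hSd : ContDiff ℝ 1 S := contDiff_id.add (hP.comp hG)
  have hKd : Differentiable ℝ K := by
    have hSd' : Differentiable ℝ S := hSd.differentiable (by norm_num)
    simp only [hK, dotp]
    fun_prop
  have hinv : ∀ r, ∃ g : RN N → RN N, DifferentiableAt ℝ g (S r) ∧
      ∀ᶠ p in 𝓝 (S r), S (g p) = p := by
    intro r
    have hstrict : HasStrictFDerivAt S (fderiv ℝ S r) r :=
      hSd.contDiffAt.hasStrictFDerivAt (by norm_num)
    have hder : fderiv ℝ S r = ContinuousLinearMap.id ℝ (RN N)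
        + (fderiv ℝ (grad ψ) (grad H r)).comp (fderiv ℝ (grad H) r) :=
      ((hasFDerivAt_id r).add ((hPd (grad H r)).hasFDerivAt.comp r (hGd r).hasFDerivAt)).fderiv
    have hinj : Function.Injective (fderiv ℝ S r : RN N →ₗ[ℝ] RN N) := by
      rw [injective_iff_map_eq_zero]
      intro v hv
      rw [hder] at hv
      exact eq_zero_of_add_comp_eq_zero (A := fderiv ℝ (grad ψ) (grad H r))
        (B := fderiv ℝ (grad H) r) (hψc.dotp_fderiv_grad_nonneg hψ _)
        (hc.dotp_fderiv_grad_nonneg hH r) (dotp_fderiv_grad_symm hH r) hv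
    set e : RN N ≃L[ℝ] RN N :=
      (LinearEquiv.ofInjectiveEndo (fderiv ℝ S r : RN N →ₗ[ℝ] RN N) hinj).toContinuousLinearEquiv
    have hstrict' : HasStrictFDerivAt S (e : RN N →L[ℝ] RN N) r := by
      convert hstrict using 1
      ext v
      rfl
    exact ⟨hstrict'.localInverse, hstrict'.to_localInverse.hasFDerivAt.differentiableAt,
      hstrict'.eventually_right_inverse⟩
  have hHd : Differentiable ℝ Hη := by
    intro p
    obtain ⟨r, rfl⟩ := hsurj p
    obtain ⟨g, hg, hgS⟩ := hinv r
    have : Hη =ᶠ[𝓝 (S r)] fun p => K (g p) := hgS.mono fun p hp => by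
      change _ = K (g p)
      rw [← hHS, hp]
    exact ((hKd _).comp _ hg).congr_of_eventuallyEq this
  have hgrad : ∀ r, grad Hη (S r) = grad H r := by
    intro r
    refine IsLocalMin.grad_eq_of_sub_dotp (hHd _) fun p' => ?_
    obtain ⟨r', rfl⟩ := hsurj p'
    have := hbη r' (grad H r)
    rw [hHS r]
    simp only [hK]
    rw [Leg_grad hc hd] at this
    linarith
  intro p
  obtain ⟨r, rfl⟩ := hsurj p
  obtain ⟨g, hg, hgS⟩ := hinv r
  have : grad Hη =ᶠ[𝓝 (S r)] fun p => grad H (g p) :=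
    hgS.mono fun p hp => by
    change _ = grad H (g p)
    rw [← hgrad, hp]
  exact ((hGd _).comp _ hg).congr_of_eventuallyEq this

lemma bddAbove_dotp_sub {N : ℕ} {H : RN N → ℝ} {C γ : ℝ} (hC : 0 < C) (hγ : 1 < γ)
    (hH : ∀ p, C⁻¹ * euclNorm p ^ γ ≤ H p) (q : RN N) :
    BddAbove (range fun p => dotp p q - H p) := by
  refine ⟨(C * euclNorm q) ^ (1 / (γ - 1)) * euclNorm q, ?_⟩
  rintro _ ⟨p, rfl⟩
  have h1 := dotp_le_euclNorm p q
  have h2 := hH p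
  have hp := euclNorm_nonneg p
  have hq := euclNorm_nonneg q
  set s := euclNorm p
  set a := euclNorm q
  have hg : 0 < γ - 1 := by linarith
  have h3 : 0 ≤ (C * a) ^ (1 / (γ - 1)) * a := by positivity
  rcases le_or_gt (C * a) (s ^ (γ - 1)) with h | h
  · have h4 : s * a ≤ C⁻¹ * s ^ γ := by
      rcases hp.eq_or_lt with h0 | h0
      · rw [← h0, zero_mul]; positivity
      · have e : s ^ γ = s * s ^ (γ - 1) := by
          rw [← Real.rpow_one_add' hp (by linarith)]; congr 1; ring
        rw [e]
        calc s * a = C⁻¹ * (s * (C * a)) := by field_simp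
          _ ≤ _ := by gcongr
    simp only
    linarith
  · have h4 : s ≤ (C * a) ^ (1 / (γ - 1)) := by
      have := Real.rpow_le_rpow (by positivity) h.le (by positivity : 0 ≤ 1 / (γ - 1))
      rwa [← Real.rpow_mul hp, mul_one_div_cancel hg.ne', Real.rpow_one] at this
    have h5 : s * a ≤ (C * a) ^ (1 / (γ - 1)) * a := by gcongr
    have h6 : 0 ≤ C⁻¹ * s ^ γ := by positivity
    simp only
    linarith

lemma convexOn_euclNorm {N : ℕ} : ConvexOn ℝ univ (euclNorm : RN N → ℝ) := by
  have e : (euclNorm : RN N → ℝ) =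
      norm ∘ ((WithLp.linearEquiv 2 ℝ (RN N)).symm : RN N →ₗ[ℝ] EuclideanSpace ℝ (Fin N)) := by
    funext p
    simp [EuclideanSpace.norm_eq, euclNorm]
  rw [e]
  exact convexOn_univ_norm.comp_linearMap _

lemma contDiff_euclNorm_pow {N : ℕ} : ContDiff ℝ 2 fun q : RN N => euclNorm q ^ ((N : ℝ) + 3) := by
  have e : (fun q : RN N => euclNorm q ^ ((N : ℝ) + 3))
      = fun q => (∑ i, q i ^ 2) ^ (((N : ℝ) + 3) / 2) := by
    funext q
    rw [euclNorm, Real.sqrt_eq_rpow, ← Real.rpow_mul (Finset.sum_nonneg fun _ _ => sq_nonneg _)]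
    congr 1; ring
  rw [e]
  have h : ((2 : ℕ) : ℝ) ≤ ((N : ℝ) + 3) / 2 ∨ N = 0 := by
    rcases Nat.eq_zero_or_pos N with h | h
    · exact Or.inr h
    · left
      have : (1 : ℝ) ≤ N := by exact_mod_cast h
      push_cast; linarith
  rcases h with h | rfl
  · exact (Real.contDiff_rpow_const_of_le h).comp (by fun_prop)
  · simp only [Finset.univ_eq_empty, Finset.sum_empty]
    exact contDiff_const

lemma convexOn_euclNorm_pow {N : ℕ} :
    ConvexOn ℝ univ fun q : RN N => euclNorm q ^ ((N : ℝ) + 3) := by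
  have h := (convexOn_euclNorm (N := N)).pow (fun q _ => euclNorm_nonneg q) (N + 3)
  have e : (fun q : RN N => euclNorm q ^ ((N : ℝ) + 3)) = euclNorm ^ (N + 3) := by
    funext q
    rw [Pi.pow_apply, ← Real.rpow_natCast]
    push_cast
    rfl
  rwa [e]

lemma differentiable_grad_Hpen {N : ℕ} {H : RN N → ℝ} {C C' γ γ' η : ℝ}
    (hc : ConvexOn ℝ univ H) (hH : ContDiff ℝ 2 H) (hC : 0 < C) (hγ : 1 < γ)
    (hHlow : ∀ p, C⁻¹ * euclNorm p ^ γ ≤ H p) (hC' : 0 < C') (hγ' : 2 < γ')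
    (hLlow : ∀ q, C'⁻¹ * euclNorm q ^ γ' - C' ≤ Leg H q) (hη : 0 ≤ η) :
    Differentiable ℝ (grad (Hpen (Leg H) η)) := by
  have hb := bddAbove_dotp_sub hC hγ hHlow
  have hLc : Continuous (Leg H) := (convexOn_Leg hb).locallyLipschitz.continuous
  have hη' : 0 ≤ η / ((N : ℝ) + 3) := by positivity
  refine differentiable_grad_Leg_add (ψ := fun q => η / ((N : ℝ) + 3) * euclNorm q ^ ((N : ℝ) + 3))
    hc hH (convexOn_euclNorm_pow.smul hη') (contDiff_const.mul contDiff_euclNorm_pow) hb ?_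
  intro p
  have hcont : Continuous fun q : RN N =>
      dotp p q - (Leg H q + η / ((N : ℝ) + 3) * euclNorm q ^ ((N : ℝ) + 3)) := by
    have := (contDiff_euclNorm_pow (N := N)).continuous
    fun_prop
  refine hcont.exists_forall_ge' 0 ?_
  set b := dotp p 0 - (Leg H 0 + η / ((N : ℝ) + 3) * euclNorm (0 : RN N) ^ ((N : ℝ) + 3))
  have hlarge : ∀ᶠ q : RN N in cocompact (RN N),
      max 1 (C' * (euclNorm p + |C' - b|)) ≤ ‖q‖ :=
    (tendsto_norm_cocompact_atTop).eventually_ge_atTop _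
  filter_upwards [hlarge] with q hq
  have hqe := hq.trans (norm_le_euclNorm q)
  have h1 : 1 ≤ euclNorm q := (le_max_left _ _).trans hqe
  have h2 := (le_max_right _ _).trans hqe
  have h3 := hLlow q
  have h4 := dotp_le_euclNorm p q
  have h5 : euclNorm q ^ (2 : ℝ) ≤ euclNorm q ^ γ' := Real.rpow_le_rpow_of_exponent_le h1 hγ'.le
  rw [Real.rpow_two] at h5
  have h6 : 0 ≤ η / ((N : ℝ) + 3) * euclNorm q ^ ((N : ℝ) + 3) :=
    mul_nonneg hη' (Real.rpow_nonneg (euclNorm_nonneg q) _)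
  have h7 : C'⁻¹ * euclNorm q ^ 2 ≤ C'⁻¹ * euclNorm q ^ γ' := by gcongr
  have h8 : euclNorm q * (euclNorm p + |C' - b|) ≤ C'⁻¹ * euclNorm q ^ 2 := by
    calc euclNorm q * (euclNorm p + |C' - b|)
        = C'⁻¹ * (euclNorm q * (C' * (euclNorm p + |C' - b|))) := by field_simp
      _ ≤ C'⁻¹ * (euclNorm q * euclNorm q) := by gcongr
      _ = _ := by ring
  have h9 : |C' - b| ≤ euclNorm q * |C' - b| := le_mul_of_one_le_left (abs_nonneg _) h1
  have h10 := le_abs_self (C' - b)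
  linarith

lemma continuous_Lpen {N : ℕ} {L : RN N → ℝ} {η : ℝ} (hL : Continuous L) :
    Continuous (Lpen L η) := by
  have := (contDiff_euclNorm_pow (N := N)).continuous
  unfold Lpen
  fun_prop

/-! ### Integration by parts on the torus -/

lemma integral_cube_dive_eq_zero {N : ℕ} {W : RN N → RN N} (hd : Differentiable ℝ W)
    (hp : ZPeriodic W) (hi : IntegrableOn (dive W) (cube N)) : ∫ x in cube N, dive W x = 0 := by
  rcases N with _ | n
  · simp [dive]
  · have hdi : ∀ i, Differentiable ℝ fun y => W y i := fun i => differentiable_pi.1 hd i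
    have h := integral_divergence_of_hasFDerivAt_off_countable' (E := ℝ) (0 : RN (n + 1)) 1
      (fun i => zero_le_one) (fun i y => W y i) (fun i y => fderiv ℝ (fun y => W y i) y) ∅
      countable_empty (fun i => (hdi i).continuous.continuousOn)
      (fun x _ i => (hdi i x).hasFDerivAt) hi
    refine (h.trans ?_)
    refine Finset.sum_eq_zero fun i _ => sub_eq_zero.2 ?_
    refine integral_congr_ae (Eventually.of_forall fun x => ?_)
    have hper := hp (i.insertNth (0 : ℝ) x) (Pi.single i 1)
    have e : (fun j => (i.insertNth (0 : ℝ) x : RN (n + 1)) j + ((Pi.single i (1 : ℤ) :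
        Fin (n + 1) → ℤ) j : ℝ)) = i.insertNth (1 : ℝ) x := by
      funext j
      refine Fin.succAboveCases i ?_ (fun k => ?_) j
      · simp
      · simp
    rw [e] at hper
    change W (i.insertNth (1 : ℝ) x) i = W (i.insertNth (0 : ℝ) x) i
    rw [hper]

lemma dive_add {N : ℕ} {V W : RN N → RN N} {x : RN N} (hV : DifferentiableAt ℝ V x)
    (hW : DifferentiableAt ℝ W x) : dive (fun y => V y + W y) x = dive V x + dive W x := by
  simp only [dive, ← Finset.sum_add_distrib, pd, Pi.add_apply]
  refine Finset.sum_congr rfl fun i _ => ?_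
  rw [fderiv_fun_add (differentiableAt_pi.1 hV i) (differentiableAt_pi.1 hW i)]
  rfl

lemma dive_smul {N : ℕ} {ρ : RN N → ℝ} {V : RN N → RN N} {x : RN N}
    (hρ : DifferentiableAt ℝ ρ x) (hV : DifferentiableAt ℝ V x) :
    dive (fun y => ρ y • V y) x = ρ x * dive V x + dotp (grad ρ x) (V x) := by
  simp only [dive, Finset.mul_sum, dotp, ← Finset.sum_add_distrib, pd, Pi.smul_apply, smul_eq_mul,
    grad]
  refine Finset.sum_congr rfl fun i _ => ?_
  rw [fderiv_fun_mul hρ (differentiableAt_pi.1 hV i)]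
  simp [mul_comm]

lemma dive_grad {N : ℕ} (u : RN N → ℝ) (x : RN N) : dive (grad u) x = lap u x := rfl

/-! ### A multiplicative Sobolev inequality on the cube -/

lemma le_integral_Icc_add_abs_deriv {g g' : ℝ → ℝ} (hg : ∀ s, HasDerivAt g (g' s) s)
    (hg' : Continuous g') {x : ℝ} (hx : x ∈ Icc (0 : ℝ) 1) :
    g x ≤ ∫ s in Icc (0 : ℝ) 1, (g s + |g' s|) := by
  have hgc : Continuous g := continuous_iff_continuousAt.2 fun s => (hg s).continuousAt
  have hint : ∀ a b, IntervalIntegrable g' volume a b := fun a b => hg'.intervalIntegrable _ _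
  have hIi : IntegrableOn (fun s => |g' s|) (Icc (0 : ℝ) 1) :=
    hg'.abs.continuousOn.integrableOn_Icc
  have key : ∀ y ∈ Icc (0 : ℝ) 1, g x - ∫ s in Icc (0 : ℝ) 1, |g' s| ≤ g y := by
    intro y hy
    have h1 := intervalIntegral.integral_eq_sub_of_hasDerivAt (fun s _ => hg s) (hint y x)
    have h2 : ∫ s in y..x, g' s ≤ ∫ s in Icc (0 : ℝ) 1, |g' s| := by
      refine (le_abs_self _).trans ?_
      calc |∫ s in y..x, g' s| ≤ ∫ s in Set.uIoc y x, |g' s| :=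
            intervalIntegral.norm_integral_le_integral_norm_uIoc (f := g')
        _ ≤ _ := by
            refine setIntegral_mono_set hIi (Eventually.of_forall fun _ => abs_nonneg _) ?_
            refine LE.le.eventuallyLE ?_
            exact uIoc_subset_uIcc.trans (uIcc_subset_Icc hy hx)
    linarith
  have h3 : ∫ _ in Icc (0 : ℝ) 1, (g x - ∫ s in Icc (0 : ℝ) 1, |g' s|)
      ≤ ∫ s in Icc (0 : ℝ) 1, g s :=
    setIntegral_mono_on (by simp) hgc.continuousOn.integrableOn_Icc measurableSet_Icc key
  rw [integral_add hgc.continuousOn.integrableOn_Icc hIi]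
  simp at h3
  linarith

lemma measurableSet_cube (N : ℕ) : MeasurableSet (cube N) := measurableSet_Icc

lemma isCompact_cube (N : ℕ) : IsCompact (cube N) := isCompact_Icc

lemma volume_restrict_cube (N : ℕ) : (volume : Measure (RN N)).restrict (cube N)
    = Measure.pi fun _ : Fin N => (volume : Measure ℝ).restrict (Icc 0 1) := by
  rw [cube, ← Set.pi_univ_Icc, volume_pi]
  exact Measure.restrict_pi_pi _ _

lemma volume_cube (N : ℕ) : (volume : Measure (RN N)) (cube N) = 1 := by
  rw [cube, Real.volume_Icc_pi]; simp

lemma memLp_cube_of_continuous {N : ℕ} {k : RN N → ℝ} (hk : Continuous k) (p : ENNReal) :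
    MemLp k p (volume.restrict (cube N)) := by
  have : IsFiniteMeasure ((volume : Measure (RN N)).restrict (cube N)) :=
    ⟨by rw [Measure.restrict_apply_univ, volume_cube]; exact ENNReal.one_lt_top⟩
  obtain ⟨C, hC⟩ := (isCompact_cube N).exists_bound_of_continuousOn hk.continuousOn
  exact MemLp.of_bound hk.aestronglyMeasurable C
    ((ae_restrict_iff' (measurableSet_cube N)).2 (Eventually.of_forall hC))

/-- For `g, h ≥ 0` with `g` of class `C¹`,
`∫ g h^{1/N} ≤ (∫ h)^{1/N} ∫ (g + ∑ⱼ |∂ⱼ g|)` on the unit cube. -/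
lemma integral_mul_rpow_inv_le {N : ℕ} (hN : 1 ≤ N) {g h : RN N → ℝ} (hgd : Differentiable ℝ g)
    (hgc : ∀ i, Continuous (pd i g))
    (hg : ∀ x, 0 ≤ g x) (hh : ∀ x, 0 ≤ h x) (hhc : Continuous h) :
    ∫ x in cube N, g x * h x ^ (1 / (N : ℝ))
      ≤ (∫ x in cube N, h x) ^ (1 / (N : ℝ)) * ∫ x in cube N, (g x + ∑ j, |pd j g x|) := by
  set f : RN N → ℝ := fun x => g x + ∑ j, |pd j g x| with hf
  have hfc : Continuous f := by
    have := hgd.continuous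
    fun_prop
  have hf0 : ∀ x, 0 ≤ f x := fun x => add_nonneg (hg x) (Finset.sum_nonneg fun _ _ => abs_nonneg _)
  have hN0 : (0 : ℝ) < N := by exact_mod_cast hN
  have hslice : ∀ x ∈ cube N, ∀ i, g x ≤ ∫ s in Icc (0 : ℝ) 1, f (Function.update x i s) := by
    intro x hx i
    have hup : ∀ s : ℝ, HasDerivAt (fun s : ℝ => Function.update x i s) (Pi.single i 1) s :=
      fun s => hasDerivAt_update x i s
    have h1 := le_integral_Icc_add_abs_deriv (g := fun s => g (Function.update x i s))
      (g' := fun s => pd i g (Function.update x i s))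
      (fun s => (hgd _).hasFDerivAt.comp_hasDerivAt s (hup s))
      ((hgc i).comp (continuous_const.update i continuous_id))
      (x := x i) ⟨hx.1 i, hx.2 i⟩
    simp only [Function.update_eq_self] at h1
    refine h1.trans (setIntegral_mono ?_ ?_ ?_)
    · have := hgd.continuous
      have h2 := hgc i
      exact (by fun_prop : Continuous fun s : ℝ =>
        g (Function.update x i s) + |pd i g (Function.update x i s)|).continuousOn.integrableOn_Icc
    · exact (by fun_prop : Continuous fun s : ℝ =>
        f (Function.update x i s)).continuousOn.integrableOn_Icc
    · intro s
      have := Finset.single_le_sum (f := fun j => |pd j g (Function.update x i s)|)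
        (fun _ _ => abs_nonneg _) (Finset.mem_univ i)
      simp only [hf] at this ⊢
      linarith
  have hInt : ∀ {k : RN N → ℝ}, Continuous k → IntegrableOn k (cube N) := fun hk =>
    hk.continuousOn.integrableOn_compact (isCompact_cube N)
  have hhr : Continuous fun x => h x ^ (1 / (N : ℝ)) :=
    hhc.rpow_const fun _ => Or.inr (by positivity)
  rcases hN.eq_or_lt with rfl | hN2
  · simp only [Nat.cast_one, div_one, Real.rpow_one]
    have hconst : ∀ x ∈ cube 1, g x ≤ ∫ y in cube 1, f y := by
      intro x hx
      refine (hslice x hx 0).trans (le_of_eq ?_)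
      have hmp := (volume_preserving_funUnique (Fin 1) ℝ).symm
      have := hmp.setIntegral_preimage_emb (MeasurableEquiv.measurableEmbedding _) f (cube 1)
      refine Eq.trans ?_ this
      have hset : (MeasurableEquiv.funUnique (Fin 1) ℝ).symm ⁻¹' cube 1 = Icc 0 1 := by
        ext s
        simp [cube, Pi.le_def]
      rw [hset]
      refine integral_congr_ae (Eventually.of_forall fun s => ?_)
      simp only
      congr 1
      funext j
      have : j = 0 := Subsingleton.elim _ _
      subst this
      simp
    calc ∫ x in cube 1, g x * h x ≤ ∫ x in cube 1, (∫ y in cube 1, f y) * h x := by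
          refine setIntegral_mono_on (hInt (hgd.continuous.mul hhc))
            (hInt (continuous_const.mul hhc)) (measurableSet_cube 1) fun x hx => ?_
          exact mul_le_mul_of_nonneg_right (hconst x hx) (hh x)
      _ = _ := by rw [integral_const_mul, mul_comm]
  · have hN1 : (0 : ℝ) < (N : ℝ) - 1 := by
      have : (1 : ℝ) < N := by exact_mod_cast hN2
      linarith
    set p : ℝ := N / (N - 1) with hp
    have hpq : (Fintype.card (Fin N) : ℝ).HolderConjugate p := by
      rw [Fintype.card_fin, Real.holderConjugate_iff]
      refine ⟨by linarith, ?_⟩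
      rw [hp]; field_simp; ring
    have hpq' : p.HolderConjugate N := by simpa using hpq.symm
    have hp0 : 0 < p := hpq'.pos
    have hpow : ∫ x in cube N, g x ^ p ≤ (∫ x in cube N, f x) ^ p := by
      have hgp : Continuous fun x => g x ^ p := hgd.continuous.rpow_const fun _ => Or.inr hp0.le
      have hL : ∫⁻ x in cube N, ENNReal.ofReal (g x ^ p)
          ≤ (∫⁻ x in cube N, ENNReal.ofReal (f x)) ^ p := by
        have hgns := lintegral_prod_lintegral_pow_le
          (μ := fun _ : Fin N => (volume : Measure ℝ).restrict (Icc 0 1)) hpq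
          (f := fun x => ENNReal.ofReal (f x)) (by fun_prop)
        rw [← volume_restrict_cube, Fintype.card_fin] at hgns
        refine le_trans ?_ hgns
        refine setLIntegral_mono' (measurableSet_cube N) fun x hx => ?_
        have hx1 : ∀ i, ENNReal.ofReal (g x)
            ≤ ∫⁻ s in Icc (0 : ℝ) 1, ENNReal.ofReal (f (Function.update x i s)) := by
          intro i
          rw [← ofReal_integral_eq_lintegral_ofReal]
          · exact ENNReal.ofReal_le_ofReal (hslice x hx i)
          · exact (by fun_prop : Continuous fun s : ℝ =>
              f (Function.update x i s)).continuousOn.integrableOn_Icc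
          · exact Eventually.of_forall fun s => hf0 _
        calc ENNReal.ofReal (g x ^ p)
            = ∏ _i : Fin N, ENNReal.ofReal (g x) ^ (1 / ((N : ℝ) - 1)) := by
              rw [Finset.prod_const, Finset.card_univ, Fintype.card_fin, ← ENNReal.rpow_natCast,
                ← ENNReal.rpow_mul, ← ENNReal.ofReal_rpow_of_nonneg (hg x) hp0.le]
              congr 1; rw [hp]; ring
          _ ≤ _ := by
              refine Finset.prod_le_prod' fun i _ => ?_
              exact ENNReal.rpow_le_rpow (hx1 i) (by positivity)
      rw [← ofReal_integral_eq_lintegral_ofReal (hInt hgp)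
          (Eventually.of_forall fun x => Real.rpow_nonneg (hg x) _),
        ← ofReal_integral_eq_lintegral_ofReal (hInt hfc) (Eventually.of_forall hf0),
        ENNReal.ofReal_rpow_of_nonneg (integral_nonneg hf0) hp0.le] at hL
      exact (ENNReal.ofReal_le_ofReal_iff (Real.rpow_nonneg (integral_nonneg hf0) _)).1 hL
    have hHol := integral_mul_le_Lp_mul_Lq_of_nonneg (μ := volume.restrict (cube N)) hpq'
      (f := g) (g := fun x => h x ^ (1 / (N : ℝ))) (Eventually.of_forall hg)
      (Eventually.of_forall fun x => Real.rpow_nonneg (hh x) _)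
      (memLp_cube_of_continuous hgd.continuous _) (memLp_cube_of_continuous hhr _)
    refine hHol.trans ?_
    rw [mul_comm]
    have e1 : ∀ x, (h x ^ (1 / (N : ℝ))) ^ (N : ℝ) = h x := fun x => by
      rw [← Real.rpow_mul (hh x), one_div_mul_cancel hN0.ne', Real.rpow_one]
    simp only [e1]
    have e2 : (∫ x in cube N, g x ^ p) ^ (1 / p) ≤ ∫ x in cube N, f x := by
      have := Real.rpow_le_rpow (integral_nonneg fun x => Real.rpow_nonneg (hg x) _) hpow
        (by positivity : 0 ≤ 1 / p)
      rwa [← Real.rpow_mul (integral_nonneg hf0), mul_one_div_cancel hp0.ne', Real.rpow_one] at this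
    exact mul_le_mul_of_nonneg_left e2 (Real.rpow_nonneg (integral_nonneg hh) _)

lemma pd_rpow {N : ℕ} {M : RN N → ℝ} {x : RN N} (hM : DifferentiableAt ℝ M x) (h1 : 0 < M x)
    (a : ℝ) (i : Fin N) : pd i (fun y => M y ^ a) x = a * M x ^ (a - 1) * pd i M x := by
  rw [pd, (hM.hasFDerivAt.rpow_const (p := a) (Or.inl h1.ne')).fderiv]
  rfl

lemma grad_rpow {N : ℕ} {M : RN N → ℝ} {x : RN N} (hM : DifferentiableAt ℝ M x) (h1 : 0 < M x)
    (a : ℝ) : grad (fun y => M y ^ a) x = (a * M x ^ (a - 1)) • grad M x := by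
  funext i
  exact pd_rpow hM h1 a i

lemma mul_le_weighted_sq {μ : ℝ} (hμ : 0 < μ) (a b : ℝ) :
    a * b ≤ μ / 2 * a ^ 2 + 1 / (2 * μ) * b ^ 2 := by
  have h : 0 ≤ (1 / (2 * μ)) * (μ * a - b) ^ 2 := by positivity
  have e : (1 / (2 * μ)) * (μ * a - b) ^ 2 = μ / 2 * a ^ 2 + 1 / (2 * μ) * b ^ 2 - a * b := by
    field_simp; ring
  linarith

/-- A Gagliardo–Nirenberg inequality for powers of a function `M ≥ 1` on the unit cube. -/
lemma integral_rpow_le_gagliardo {N : ℕ} (hN : 1 ≤ N) {β c : ℝ} (hβ : 0 ≤ β) (hc : 0 ≤ c)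
    {M : RN N → ℝ} (hMd : Differentiable ℝ M) (hMc : ∀ i, Continuous (pd i M))
    (hM : ∀ x, 1 ≤ M x) :
    ∫ x in cube N, M x ^ (β + 1 + 2 * c / N)
      ≤ (1 + (β + 1 + c / N) * N) ^ 2 * (∫ x in cube N, M x ^ c) ^ (2 / (N : ℝ)) *
        ((∫ x in cube N, M x ^ (β - 1) * dotp (grad M x) (grad M x))
          + ∫ x in cube N, M x ^ (β + 1)) := by
  have hN0 : (0 : ℝ) < N := by exact_mod_cast hN
  have hN1 : (1 : ℝ) ≤ N := by exact_mod_cast hN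
  have hM0 : ∀ x, 0 < M x := fun x => zero_lt_one.trans_le (hM x)
  have hcont : ∀ a : ℝ, Continuous fun x => M x ^ a := fun a =>
    hMd.continuous.rpow_const fun x => Or.inl (hM0 x).ne'
  have hgradc : Continuous (grad M) := continuous_pi hMc
  have hInt : ∀ {k : RN N → ℝ}, Continuous k → IntegrableOn k (cube N) := fun hk =>
    hk.continuousOn.integrableOn_compact (isCompact_cube N)
  set a := β + 1 + c / N with ha
  have ha1 : 1 ≤ a := by have : 0 ≤ c / N := by positivity
                         linarith
  set R := β + 1 + 2 * c / N with hR
  set k := 1 + a * N with hk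
  have hka : a ≤ k := by nlinarith
  have hk1 : 1 ≤ k := by have : 0 ≤ a * N := by positivity
                         linarith
  set X := ∫ x in cube N, M x ^ R with hX
  set P := (∫ x in cube N, M x ^ c) ^ (1 / (N : ℝ)) with hP
  have hmass : 0 < ∫ x in cube N, M x ^ c := by
    have h1 : ∫ _ in cube N, (1 : ℝ) ≤ ∫ x in cube N, M x ^ c :=
      setIntegral_mono (hInt continuous_const) (hInt (hcont c)) fun x =>
        Real.one_le_rpow (hM x) hc
    have h2 : ∫ _ in cube N, (1 : ℝ) = 1 := by
      rw [setIntegral_const, measureReal_def, volume_cube]; simp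
    linarith
  have hP0 : 0 < P := Real.rpow_pos_of_pos hmass _
  have hsob := integral_mul_rpow_inv_le hN (g := fun x => M x ^ a) (h := fun x => M x ^ c)
    (fun x => ((hMd x).hasFDerivAt.rpow_const (Or.inl (hM0 x).ne')).differentiableAt)
    (fun i => by
      have : pd i (fun x => M x ^ a) = fun x => a * M x ^ (a - 1) * pd i M x :=
        funext fun x => pd_rpow (hMd x) (hM0 x) a i
      rw [this]
      exact (continuous_const.mul (hcont _)).mul (hMc i))
    (fun x => (Real.rpow_pos_of_pos (hM0 x) _).le) (fun x => (Real.rpow_pos_of_pos (hM0 x) _).le)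
    (hcont c)
  have e1 : ∀ x, M x ^ a * (M x ^ c) ^ (1 / (N : ℝ)) = M x ^ R := fun x => by
    rw [← Real.rpow_mul (hM0 x).le, ← Real.rpow_add (hM0 x)]
    congr 1; rw [ha, hR]; ring
  simp only [e1] at hsob
  set D := ∫ x in cube N, M x ^ (β - 1) * dotp (grad M x) (grad M x) with hD
  set Y := ∫ x in cube N, M x ^ (β + 1) with hY
  set μ := 1 / (k * P) with hμ
  have hμ0 : 0 < μ := by positivity
  have hDc : Continuous fun x => M x ^ (β - 1) * dotp (grad M x) (grad M x) := by
    have := hcont (β - 1)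
    have h2 : Continuous fun x => dotp (grad M x) (grad M x) :=
      continuous_dotp.comp (hgradc.prodMk hgradc)
    exact this.mul h2
  have hbound : ∫ x in cube N, (M x ^ a + ∑ j, |pd j (fun y => M y ^ a) x|)
      ≤ k * (μ / 2 * X + 1 / (2 * μ) * (D + Y)) := by
    have hrhs : k * (μ / 2 * X + 1 / (2 * μ) * (D + Y)) = ∫ x in cube N,
        k * (μ / 2 * M x ^ R
          + 1 / (2 * μ) * (M x ^ (β - 1) * dotp (grad M x) (grad M x) + M x ^ (β + 1))) := by
      have hi : IntegrableOn (fun x => 1 / (2 * μ) * (M x ^ (β - 1) * dotp (grad M x) (grad M x)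
          + M x ^ (β + 1))) (cube N) := ((hInt hDc).add (hInt (hcont _))).const_mul _
      rw [integral_const_mul, integral_add ((hInt (hcont R)).const_mul _) hi, integral_const_mul,
        integral_const_mul, integral_add (hInt hDc) (hInt (hcont _))]
    rw [hrhs]
    refine setIntegral_mono (hInt ?_) (hInt ?_) ?_
    · have e : (fun x => M x ^ a + ∑ j, |pd j (fun y => M y ^ a) x|)
          = fun x => M x ^ a + ∑ j, |a * M x ^ (a - 1) * pd j M x| :=
        funext fun x => by simp only [pd_rpow (hMd x) (hM0 x)]
      rw [e]
      have h1 := hcont a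
      have h2 := hcont (a - 1)
      fun_prop
    · have h1 := hcont R
      have h2 := hcont (β + 1)
      fun_prop
    · intro x
      simp only [pd_rpow (hMd x) (hM0 x), abs_mul, abs_of_nonneg (zero_le_one.trans ha1),
        abs_of_pos (Real.rpow_pos_of_pos (hM0 x) _)]
      set u := M x ^ ((β + 1) / 2 + c / N) with hu
      set v := M x ^ ((β - 1) / 2) with hv
      have hu0 : 0 < u := Real.rpow_pos_of_pos (hM0 x) _
      have hv0 : 0 < v := Real.rpow_pos_of_pos (hM0 x) _
      have e2 : M x ^ (a - 1) = u * v := by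
        rw [hu, hv, ← Real.rpow_add (hM0 x)]; congr 1; rw [ha]; ring
      have e3 : M x ^ R = u ^ 2 := by
        rw [hu, ← Real.rpow_natCast, ← Real.rpow_mul (hM0 x).le]; congr 1; rw [hR]; push_cast; ring
      have e4 : M x ^ (β - 1) = v ^ 2 := by
        rw [hv, ← Real.rpow_natCast, ← Real.rpow_mul (hM0 x).le]; congr 1; push_cast; ring
      have e5 : M x ^ (β + 1) = (v * M x) ^ 2 := by
        rw [mul_pow, ← e4, ← Real.rpow_natCast (M x) 2, ← Real.rpow_add (hM0 x)]
        congr 1; push_cast; ring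
      have e6 : M x ^ a = u * (v * M x) := by
        rw [← mul_assoc, ← e2, ← Real.rpow_add_one (hM0 x).ne']; congr 1; ring
      rw [e2, e3, e4, e5, e6]
      have h1 := mul_le_weighted_sq hμ0 u (v * M x)
      have h2 : ∑ j, a * (u * v) * |pd j M x|
          ≤ a * (N * (μ / 2 * u ^ 2) + 1 / (2 * μ) * (v ^ 2 * dotp (grad M x) (grad M x))) := by
        have : ∀ j, a * (u * v) * |pd j M x|
            ≤ a * (μ / 2 * u ^ 2 + 1 / (2 * μ) * (v ^ 2 * (pd j M x * pd j M x))) := by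
          intro j
          have := mul_le_weighted_sq hμ0 u (v * |pd j M x|)
          rw [mul_pow, sq_abs] at this
          rw [mul_assoc a]
          refine mul_le_mul_of_nonneg_left ?_ (by linarith)
          nlinarith
        refine (Finset.sum_le_sum fun j _ => this j).trans (le_of_eq ?_)
        rw [← Finset.mul_sum, Finset.sum_add_distrib, ← Finset.mul_sum, ← Finset.mul_sum,
          Finset.sum_const, Finset.card_univ, Fintype.card_fin, nsmul_eq_mul, ← Finset.mul_sum]
        change _ = a * (N * (μ / 2 * u ^ 2) + 1 / (2 * μ) * (v ^ 2 * ∑ i, pd i M x * pd i M x))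
        ring
      have hdd := dotp_self_nonneg (grad M x)
      have h3 : 0 ≤ 1 / (2 * μ) * (v ^ 2 * dotp (grad M x) (grad M x)) := by positivity
      have h4 : 0 ≤ 1 / (2 * μ) * (v * M x) ^ 2 := by positivity
      have h5 : 0 ≤ (k - a) * (1 / (2 * μ) * (v ^ 2 * dotp (grad M x) (grad M x))) :=
        mul_nonneg (by linarith) h3
      have h6 : 0 ≤ (k - 1) * (1 / (2 * μ) * (v * M x) ^ 2) := mul_nonneg (by linarith) h4
      have h7 : k * (μ / 2 * u ^ 2) = μ / 2 * u ^ 2 + a * (N * (μ / 2 * u ^ 2)) := by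
        rw [hk]; ring
      linarith
  have hfin : X ≤ P * (k * (μ / 2 * X + 1 / (2 * μ) * (D + Y))) :=
    hsob.trans (mul_le_mul_of_nonneg_left hbound hP0.le)
  have e7 : P * (k * (μ / 2 * X + 1 / (2 * μ) * (D + Y)))
      = X / 2 + k ^ 2 * P ^ 2 * (D + Y) / 2 := by
    rw [hμ]; field_simp
  have e8 : P ^ 2 = (∫ x in cube N, M x ^ c) ^ (2 / (N : ℝ)) := by
    rw [hP, ← Real.rpow_natCast, ← Real.rpow_mul hmass.le]; congr 1; push_cast; ring
  rw [← e8]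
  linarith

/-! ### Integration over the space-time cylinder -/

section Cylinder

variable {N : ℕ} {T : ℝ}

lemma measurableSet_QQ : MeasurableSet (QQ N T) := (measurableSet_cube N).prod measurableSet_Ioo

lemma QQ_subset : QQ N T ⊆ cube N ×ˢ Icc 0 T := prod_mono_right Ioo_subset_Icc_self

lemma ContinuousOn.integrableOn_QQ {E : Type*} [NormedAddCommGroup E] {k : RN N × ℝ → E}
    (hk : ContinuousOn k (univ ×ˢ Icc 0 T)) : IntegrableOn k (QQ N T) :=
  ((hk.mono (prod_mono_left (subset_univ _))).integrableOn_compact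
    ((isCompact_cube N).prod isCompact_Icc)).mono_set QQ_subset

lemma ContinuousOn.continuous_slice {E : Type*} [TopologicalSpace E] {k : RN N × ℝ → E}
    (hk : ContinuousOn k (univ ×ˢ Icc 0 T)) {t : ℝ} (ht : t ∈ Icc 0 T) :
    Continuous fun x => k (x, t) :=
  hk.comp_continuous (by fun_prop) fun _ => ⟨mem_univ _, ht⟩

lemma ContinuousOn.continuousOn_fiber {E : Type*} [TopologicalSpace E] {k : RN N × ℝ → E}
    (hk : ContinuousOn k (univ ×ˢ Icc 0 T)) (x : RN N) :
    ContinuousOn (fun t => k (x, t)) (Icc 0 T) :=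
  hk.comp (by fun_prop) fun _ ht => ⟨mem_univ _, ht⟩

lemma Continuous.integrableOn_cube {E : Type*} [NormedAddCommGroup E] {k : RN N → E}
    (hk : Continuous k) : IntegrableOn k (cube N) :=
  hk.continuousOn.integrableOn_compact (isCompact_cube N)

lemma volume_restrict_QQ : (volume : Measure (RN N × ℝ)).restrict (QQ N T)
    = ((volume : Measure (RN N)).restrict (cube N)).prod
      ((volume : Measure ℝ).restrict (Ioo 0 T)) := by
  rw [QQ, Measure.volume_eq_prod, Measure.prod_restrict]

lemma volume_real_QQ (hT : 0 ≤ T) : (volume : Measure (RN N × ℝ)).real (QQ N T) = T := by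
  rw [QQ, Measure.volume_eq_prod, measureReal_def, Measure.prod_prod, volume_cube, one_mul,
    Real.volume_Ioo, sub_zero, ENNReal.toReal_ofReal hT]

lemma integrableOn_integral_cube {k : RN N → ℝ → ℝ}
    (hk : IntegrableOn (fun q : RN N × ℝ => k q.1 q.2) (QQ N T)) :
    IntegrableOn (fun t => ∫ x in cube N, k x t) (Ioo 0 T) := by
  rw [IntegrableOn, volume_restrict_QQ] at hk
  exact hk.integral_prod_right

lemma intQ_eq_integral_Ioo {k : RN N → ℝ → ℝ}
    (hk : IntegrableOn (fun q : RN N × ℝ => k q.1 q.2) (QQ N T)) :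
    intQ N T k = ∫ t in Ioo 0 T, ∫ x in cube N, k x t := by
  rw [IntegrableOn, volume_restrict_QQ] at hk
  rw [intQ, volume_restrict_QQ]
  exact integral_prod_symm _ hk

lemma intQ_eq_integral_cube {k : RN N → ℝ → ℝ}
    (hk : IntegrableOn (fun q : RN N × ℝ => k q.1 q.2) (QQ N T)) :
    intQ N T k = ∫ x in cube N, ∫ t in Ioo 0 T, k x t := by
  rw [IntegrableOn, volume_restrict_QQ] at hk
  rw [intQ, volume_restrict_QQ]
  exact integral_prod _ hk

lemma intQ_mono {k l : RN N → ℝ → ℝ}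
    (hk : IntegrableOn (fun q : RN N × ℝ => k q.1 q.2) (QQ N T))
    (hl : IntegrableOn (fun q : RN N × ℝ => l q.1 q.2) (QQ N T))
    (h : ∀ x ∈ cube N, ∀ t ∈ Ioo 0 T, k x t ≤ l x t) : intQ N T k ≤ intQ N T l :=
  setIntegral_mono_on hk hl measurableSet_QQ fun q hq => h q.1 hq.1 q.2 hq.2

lemma intQ_nonneg {k : RN N → ℝ → ℝ} (h : ∀ x, ∀ t ∈ Ioo 0 T, 0 ≤ k x t) : 0 ≤ intQ N T k :=
  setIntegral_nonneg measurableSet_QQ fun q hq => h q.1 q.2 hq.2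

lemma intQ_mono_time {k : RN N → ℝ → ℝ}
    (hk : IntegrableOn (fun q : RN N × ℝ => k q.1 q.2) (QQ N T))
    (h : ∀ x, ∀ t ∈ Ioo 0 T, 0 ≤ k x t) {s : ℝ} (hs : s ≤ T) : intQ N s k ≤ intQ N T k := by
  refine setIntegral_mono_set hk ?_ (LE.le.eventuallyLE ?_)
  · exact (ae_restrict_iff' measurableSet_QQ).2 (Eventually.of_forall fun q hq => h q.1 q.2 hq.2)
  · exact prod_mono_right (Ioo_subset_Ioo_right hs)

lemma integral_cube_sub_eq_intQ_deriv (hT : 0 ≤ T) {g g' : RN N → ℝ → ℝ}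
    (hg : ContinuousOn (fun q : RN N × ℝ => g q.1 q.2) (univ ×ˢ Icc 0 T))
    (hg' : ContinuousOn (fun q : RN N × ℝ => g' q.1 q.2) (univ ×ˢ Icc 0 T))
    (hd : ∀ x, ∀ t ∈ Ioo 0 T, HasDerivAt (g x) (g' x t) t) :
    (∫ x in cube N, g x T) - ∫ x in cube N, g x 0 = intQ N T g' := by
  rw [intQ_eq_integral_cube hg'.integrableOn_QQ, ← integral_sub
    (hg.continuous_slice (right_mem_Icc.2 hT)).integrableOn_cube
    (hg.continuous_slice (left_mem_Icc.2 hT)).integrableOn_cube]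
  refine integral_congr_ae (Eventually.of_forall fun x => ?_)
  simp only
  rw [← integral_Ioc_eq_integral_Ioo, ← intervalIntegral.integral_of_le hT]
  refine (intervalIntegral.integral_eq_sub_of_hasDerivAt_of_le hT (hg.continuousOn_fiber x)
    (hd x) ?_).symm
  exact (by simpa [uIcc_of_le hT] using hg'.continuousOn_fiber x :
    ContinuousOn (g' x) (uIcc 0 T)).intervalIntegrable

end Cylinder

/-! ### Energy estimates for the Fokker–Planck equation -/

lemma ZPeriodic.grad {N : ℕ} {u : RN N → ℝ} (h : ZPeriodic u) : ZPeriodic (grad u) := by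
  intro x z
  funext i
  have e : (fun y => u (y + fun j => (z j : ℝ))) = u := funext fun y => h y z
  have h2 := fderiv_comp_add_right (𝕜 := ℝ) (f := u) (x := x) (fun j => (z j : ℝ))
  rw [e] at h2
  change (fderiv ℝ u (x + fun j => (z j : ℝ))) _ = _
  rw [← h2]
  rfl

/-- Testing `h = Δm + div(m A)` with `(m+1)^β` on the torus. -/
lemma integral_rpow_mul_le {N : ℕ} {β : ℝ} (hβ : 0 ≤ β) {m h : RN N → ℝ} {A : RN N → RN N}
    (hm : Differentiable ℝ m) (hg : Differentiable ℝ (grad m)) (hA : Differentiable ℝ A)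
    (hh : Continuous h) (hpm : ZPeriodic m) (hpA : ZPeriodic A) (hpg : ZPeriodic (grad m))
    (h0 : ∀ x, 0 ≤ m x) (heq : ∀ x, h x = lap m x + dive (fun y => m y • A y) x) :
    (β + 1) * ∫ x in cube N, (m x + 1) ^ β * h x
      ≤ β * (β + 1) / 2 * (∫ x in cube N, m x * (m x + 1) ^ β * euclNorm (A x) ^ 2)
        - β * (β + 1) / 2 * ∫ x in cube N, (m x + 1) ^ (β - 1) * dotp (grad m x) (grad m x) := by
  have h1 : ∀ x, 0 < m x + 1 := fun x => by linarith [h0 x]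
  have hcont : ∀ a : ℝ, Continuous fun x => (m x + 1) ^ a := fun a =>
    (hm.continuous.add continuous_const).rpow_const fun x => Or.inl (h1 x).ne'
  have hM : Differentiable ℝ fun y => m y + 1 := hm.add_const 1
  have hgr : ∀ x, grad (fun y => m y + 1) x = grad m x := fun x => by
    funext i; simp [grad, pd]
  set V : RN N → RN N := fun y => grad m y + m y • A y with hV
  have hmA : Differentiable ℝ fun y => m y • A y := hm.smul hA
  have hVd : Differentiable ℝ V := hg.add hmA
  have hdV : ∀ x, dive V x = h x := fun x => by
    rw [heq, hV, dive_add (hg x) (hmA x), dive_grad]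
  have hρ : Differentiable ℝ fun y => (m y + 1) ^ β := fun x =>
    ((hM x).hasFDerivAt.rpow_const (Or.inl (h1 x).ne')).differentiableAt
  have hdW : dive (fun y => (m y + 1) ^ β • V y)
      = fun x => (m x + 1) ^ β * h x + β * (m x + 1) ^ (β - 1) * dotp (grad m x) (V x) := by
    funext x
    rw [dive_smul (hρ x) (hVd x), hdV, grad_rpow (hM x) (h1 x), hgr, dotp_smul_left]
  have hdot : ∀ {a b : RN N → RN N}, Continuous a → Continuous b →
      Continuous fun x => dotp (a x) (b x) := fun ha hb => continuous_dotp.comp (ha.prodMk hb)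
  have hI1 : IntegrableOn (fun x => (m x + 1) ^ β * h x) (cube N) :=
    ((hcont β).mul hh).integrableOn_cube
  have hI2 : IntegrableOn (fun x => β * (m x + 1) ^ (β - 1) * dotp (grad m x) (V x)) (cube N) :=
    ((continuous_const.mul (hcont _)).mul (hdot hg.continuous hVd.continuous)).integrableOn_cube
  have hI3 : IntegrableOn (fun x => m x * (m x + 1) ^ β * euclNorm (A x) ^ 2) (cube N) :=
    ((hm.continuous.mul (hcont β)).mul
      ((continuous_euclNorm.comp hA.continuous).pow 2)).integrableOn_cube
  have hI4 : IntegrableOn (fun x => (m x + 1) ^ (β - 1) * dotp (grad m x) (grad m x)) (cube N) :=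
    ((hcont _).mul (hdot hg.continuous hg.continuous)).integrableOn_cube
  have hzero := integral_cube_dive_eq_zero (W := fun y => (m y + 1) ^ β • V y) (hρ.smul hVd)
    (fun x z => by simp only [hV]; rw [hpm x z, hpA x z, hpg x z])
    (by rw [hdW]; exact hI1.add hI2)
  rw [hdW, integral_add hI1 hI2] at hzero
  have hle : ∫ x in cube N, -(β * (m x + 1) ^ (β - 1) * dotp (grad m x) (V x))
      ≤ ∫ x in cube N, (β / 2 * (m x * (m x + 1) ^ β * euclNorm (A x) ^ 2)
        - β / 2 * ((m x + 1) ^ (β - 1) * dotp (grad m x) (grad m x))) := by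
    refine setIntegral_mono hI2.neg ((hI3.const_mul _).sub (hI4.const_mul _)) fun x => ?_
    set P := (m x + 1) ^ (β - 1) with hP
    have hP0 : 0 ≤ P := Real.rpow_nonneg (h1 x).le _
    have e1 : (m x + 1) ^ β = P * (m x + 1) := by
      rw [hP, ← Real.rpow_add_one (h1 x).ne']; congr 1; ring
    have hsq := dotp_self_nonneg (grad m x + m x • A x)
    simp only [dotp_add_left, dotp_add_right, dotp_smul_left, dotp_smul_right,
      dotp_comm (A x) (grad m x)] at hsq
    simp only [hV, dotp_add_right, dotp_smul_right, euclNorm_sq, e1]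
    have hAA := dotp_self_nonneg (A x)
    have h2 := mul_nonneg (mul_nonneg hβ hP0) hsq
    have h3 : 0 ≤ β * P * (m x * dotp (A x) (A x)) := by have := h0 x; positivity
    nlinarith
  rw [integral_neg, integral_sub (hI3.const_mul _) (hI4.const_mul _), integral_const_mul,
    integral_const_mul] at hle
  have h4 := mul_le_mul_of_nonneg_left hle (by linarith : 0 ≤ β + 1)
  have h5 := congrArg (fun z => (β + 1) * z) hzero
  linarith

/-- A nonnegative classical solution of `∂_t m - Δm - div(m A) = 0` on `T^N × [0,T]`. -/
structure FPClassical (N : ℕ) (T : ℝ) (m : RN N → ℝ → ℝ) (A : RN N → ℝ → RN N) : Prop where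
  per_m : ∀ t, ZPeriodic fun x => m x t
  per_A : ∀ t, ZPeriodic fun x => A x t
  nonneg : ∀ x t, 0 ≤ m x t
  cont_m : ContinuousOn (fun q : RN N × ℝ => m q.1 q.2) ((univ : Set (RN N)) ×ˢ Icc 0 T)
  cont_mt : ContinuousOn (fun q : RN N × ℝ => deriv (m q.1) q.2)
    ((univ : Set (RN N)) ×ˢ Icc 0 T)
  cont_dm : ContinuousOn (fun q : RN N × ℝ => grad (fun y => m y q.2) q.1)
    ((univ : Set (RN N)) ×ˢ Icc 0 T)
  cont_A : ContinuousOn (fun q : RN N × ℝ => A q.1 q.2) ((univ : Set (RN N)) ×ˢ Icc 0 T)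
  tdiff_m : ∀ x, ∀ t ∈ Ioo 0 T, DifferentiableAt ℝ (m x) t
  diff_m : ∀ t ∈ Ioo 0 T, Differentiable ℝ fun y => m y t
  diff_dm : ∀ t ∈ Ioo 0 T, Differentiable ℝ (grad fun y => m y t)
  diff_A : ∀ t ∈ Ioo 0 T, Differentiable ℝ fun y => A y t
  fkp : ∀ x, ∀ t ∈ Ioo 0 T,
    deriv (m x) t = lap (fun y => m y t) x + dive (fun y => m y t • A y t) x

namespace FPClassical

variable {N : ℕ} {T : ℝ} {m : RN N → ℝ → ℝ} {A : RN N → ℝ → RN N}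

lemma mono (h : FPClassical N T m A) {s : ℝ} (hs : s ≤ T) : FPClassical N s m A where
  per_m := h.per_m
  per_A := h.per_A
  nonneg := h.nonneg
  cont_m := h.cont_m.mono (prod_mono_right (Icc_subset_Icc_right hs))
  cont_mt := h.cont_mt.mono (prod_mono_right (Icc_subset_Icc_right hs))
  cont_dm := h.cont_dm.mono (prod_mono_right (Icc_subset_Icc_right hs))
  cont_A := h.cont_A.mono (prod_mono_right (Icc_subset_Icc_right hs))
  tdiff_m x t ht := h.tdiff_m x t (Ioo_subset_Ioo_right hs ht)
  diff_m t ht := h.diff_m t (Ioo_subset_Ioo_right hs ht)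
  diff_dm t ht := h.diff_dm t (Ioo_subset_Ioo_right hs ht)
  diff_A t ht := h.diff_A t (Ioo_subset_Ioo_right hs ht)
  fkp x t ht := h.fkp x t (Ioo_subset_Ioo_right hs ht)

lemma one_le_add_one (h : FPClassical N T m A) (x : RN N) (t : ℝ) : 1 ≤ m x t + 1 := by
  linarith [h.nonneg x t]

lemma add_one_pos (h : FPClassical N T m A) (x : RN N) (t : ℝ) : 0 < m x t + 1 := by
  linarith [h.nonneg x t]

lemma cont_rpow (h : FPClassical N T m A) (a : ℝ) :
    ContinuousOn (fun q : RN N × ℝ => (m q.1 q.2 + 1) ^ a) (univ ×ˢ Icc 0 T) :=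
  (h.cont_m.add continuousOn_const).rpow_const fun _ _ => Or.inl (h.add_one_pos _ _).ne'

lemma cont_diss (h : FPClassical N T m A) (β : ℝ) :
    ContinuousOn (fun q : RN N × ℝ => (m q.1 q.2 + 1) ^ (β - 1) *
      dotp (grad (fun y => m y q.2) q.1) (grad (fun y => m y q.2) q.1)) (univ ×ˢ Icc 0 T) :=
  (h.cont_rpow _).mul (continuous_dotp.comp_continuousOn (h.cont_dm.prodMk h.cont_dm))

lemma cont_euclNorm_A (h : FPClassical N T m A) {a : ℝ} (ha : 0 ≤ a) :
    ContinuousOn (fun q : RN N × ℝ => euclNorm (A q.1 q.2) ^ a) (univ ×ˢ Icc 0 T) :=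
  (continuous_euclNorm.comp_continuousOn h.cont_A).rpow_const fun _ _ => Or.inr ha

lemma cont_drift (h : FPClassical N T m A) (β : ℝ) :
    ContinuousOn (fun q : RN N × ℝ => m q.1 q.2 * (m q.1 q.2 + 1) ^ β *
      euclNorm (A q.1 q.2) ^ 2) (univ ×ˢ Icc 0 T) :=
  (h.cont_m.mul (h.cont_rpow β)).mul ((continuous_euclNorm.comp_continuousOn h.cont_A).pow 2)

lemma energy_inequality (h : FPClassical N T m A) (hT : 0 ≤ T) {β : ℝ} (hβ : 0 ≤ β) :
    (∫ x in cube N, (m x T + 1) ^ (β + 1))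
      + β * (β + 1) / 2 * intQ N T (fun x t => (m x t + 1) ^ (β - 1) *
          dotp (grad (fun y => m y t) x) (grad (fun y => m y t) x))
      ≤ (∫ x in cube N, (m x 0 + 1) ^ (β + 1))
        + β * (β + 1) / 2 * intQ N T (fun x t => m x t * (m x t + 1) ^ β *
          euclNorm (A x t) ^ 2) := by
  have hder := integral_cube_sub_eq_intQ_deriv hT (g := fun x t => (m x t + 1) ^ (β + 1))
    (g' := fun x t => (β + 1) * ((m x t + 1) ^ β * deriv (m x) t)) (h.cont_rpow _)
    (continuousOn_const.mul ((h.cont_rpow β).mul h.cont_mt)) (fun x t ht => by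
      have := (((h.tdiff_m x t ht).hasDerivAt.add_const 1).rpow_const (p := β + 1)
        (Or.inl (h.add_one_pos x t).ne'))
      convert this using 1
      rw [add_sub_cancel_right]; ring)
  have hD := (h.cont_diss β).integrableOn_QQ
  have hB := (h.cont_drift β).integrableOn_QQ
  have hG := (continuousOn_const (c := β + 1)).mul ((h.cont_rpow β).mul h.cont_mt)
    |>.integrableOn_QQ
  rw [intQ_eq_integral_Ioo hG] at hder
  rw [intQ_eq_integral_Ioo hD, intQ_eq_integral_Ioo hB]
  have hle : (∫ t in Ioo 0 T, ∫ x in cube N, (β + 1) * ((m x t + 1) ^ β * deriv (m x) t))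
      ≤ ∫ t in Ioo 0 T, (β * (β + 1) / 2 * (∫ x in cube N, m x t * (m x t + 1) ^ β *
          euclNorm (A x t) ^ 2) - β * (β + 1) / 2 * ∫ x in cube N, (m x t + 1) ^ (β - 1) *
          dotp (grad (fun y => m y t) x) (grad (fun y => m y t) x)) := by
    refine setIntegral_mono_on (integrableOn_integral_cube hG)
      (((integrableOn_integral_cube hB).const_mul _).sub
        ((integrableOn_integral_cube hD).const_mul _)) measurableSet_Ioo fun t ht => ?_
    have ht' := Ioo_subset_Icc_self ht
    rw [integral_const_mul]
    exact integral_rpow_mul_le hβ (h.diff_m t ht) (h.diff_dm t ht) (h.diff_A t ht)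
      (h.cont_mt.continuous_slice ht') (h.per_m t) (h.per_A t) (h.per_m t).grad
      (fun x => h.nonneg x t)
      (fun x => h.fkp x t ht)
  rw [integral_sub ((integrableOn_integral_cube hB).const_mul _)
        ((integrableOn_integral_cube hD).const_mul _), integral_const_mul,
        integral_const_mul] at hle
  linarith

lemma integral_rpow_le (h : FPClassical N T m A) {β : ℝ} (hβ : 0 ≤ β) {t : ℝ}
    (ht : t ∈ Icc 0 T) :
    (∫ x in cube N, (m x t + 1) ^ (β + 1)) ≤ (∫ x in cube N, (m x 0 + 1) ^ (β + 1))
      + β * (β + 1) / 2 * intQ N T (fun x t => m x t * (m x t + 1) ^ β *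
          euclNorm (A x t) ^ 2) := by
  have h1 := (h.mono ht.2).energy_inequality ht.1 hβ
  have h2 : 0 ≤ intQ N t (fun x t => (m x t + 1) ^ (β - 1) *
      dotp (grad (fun y => m y t) x) (grad (fun y => m y t) x)) := intQ_nonneg fun x s _ =>
    mul_nonneg (Real.rpow_nonneg (h.add_one_pos x s).le _) (dotp_self_nonneg _)
  have h3 := intQ_mono_time (k := fun x t => m x t * (m x t + 1) ^ β * euclNorm (A x t) ^ 2)
    (h.cont_drift β).integrableOn_QQ (fun x s _ => by
    have := h.nonneg x s
    have := h.add_one_pos x s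
    positivity) ht.2
  have h4 := mul_le_mul_of_nonneg_left h3 (by positivity : 0 ≤ β * (β + 1) / 2)
  have h5 : 0 ≤ β * (β + 1) / 2 := by positivity
  have h6 := mul_nonneg h5 h2
  linarith

lemma integral_add_one_le (h : FPClassical N T m A) {t : ℝ} (ht : t ∈ Icc 0 T) :
    (∫ x in cube N, (m x t + 1)) ≤ ∫ x in cube N, (m x 0 + 1) := by
  simpa using h.integral_rpow_le le_rfl ht

/-- Space-time integrability gain for the Fokker–Planck equation. -/
lemma intQ_rpow_le (h : FPClassical N T m A) (hN : 1 ≤ N) (hT : 0 ≤ T) {β c S : ℝ} (hβ : 0 < β)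
    (hc : 0 ≤ c) (hS : ∀ t ∈ Icc 0 T, (∫ x in cube N, (m x t + 1) ^ c) ≤ S) :
    intQ N T (fun x t => (m x t + 1) ^ (β + 1 + 2 * c / N))
      ≤ (1 + (β + 1 + c / N) * N) ^ 2 * S ^ (2 / (N : ℝ)) * ((2 / (β * (β + 1)) + T) *
        ((∫ x in cube N, (m x 0 + 1) ^ (β + 1))
      + β * (β + 1) / 2 * intQ N T (fun x t => m x t * (m x t + 1) ^ β *
          euclNorm (A x t) ^ 2))) := by
  set Y := (∫ x in cube N, (m x 0 + 1) ^ (β + 1))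
      + β * (β + 1) / 2 * intQ N T (fun x t => m x t * (m x t + 1) ^ β *
          euclNorm (A x t) ^ 2) with hY
  have hI1 := (h.cont_diss β).integrableOn_QQ
  have hI2 := (h.cont_rpow (β + 1)).integrableOn_QQ
  have hI3 := (h.cont_rpow (β + 1 + 2 * c / N)).integrableOn_QQ
  have hint0 : ∀ a t : ℝ, 0 ≤ ∫ x in cube N, (m x t + 1) ^ a := fun a t =>
    setIntegral_nonneg (measurableSet_cube N) fun x _ => Real.rpow_nonneg (h.add_one_pos x t).le _
  have hS0 : 0 ≤ S := (hint0 c 0).trans (hS 0 (left_mem_Icc.2 hT))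
  have hdiss : intQ N T (fun x t => (m x t + 1) ^ (β - 1) *
          dotp (grad (fun y => m y t) x) (grad (fun y => m y t) x)) ≤ 2 / (β * (β + 1)) * Y := by
    have h1 := h.energy_inequality hT hβ.le
    have h2 := hint0 (β + 1) T
    have h3 : 0 < β * (β + 1) / 2 := by positivity
    rw [show 2 / (β * (β + 1)) = (β * (β + 1) / 2)⁻¹ by rw [inv_div], inv_mul_eq_div,
      le_div_iff₀ h3]
    linarith
  have hmass : intQ N T (fun x t => (m x t + 1) ^ (β + 1)) ≤ T * Y := by
    rw [intQ_eq_integral_Ioo hI2]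
    calc _ ≤ ∫ _ in Ioo 0 T, Y := setIntegral_mono_on (integrableOn_integral_cube hI2)
          (by simp) measurableSet_Ioo fun t ht =>
            h.integral_rpow_le hβ.le (Ioo_subset_Icc_self ht)
      _ = T * Y := by simp [hT]
  set K := (1 + (β + 1 + c / N) * N) ^ 2 * S ^ (2 / (N : ℝ)) with hK
  have hK0 : 0 ≤ K := by positivity
  calc _ = ∫ t in Ioo 0 T, ∫ x in cube N, (m x t + 1) ^ (β + 1 + 2 * c / N) :=
        intQ_eq_integral_Ioo hI3
    _ ≤ ∫ t in Ioo 0 T, K * ((∫ x in cube N, (m x t + 1) ^ (β - 1) *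
          dotp (grad (fun y => m y t) x) (grad (fun y => m y t) x))
          + ∫ x in cube N, (m x t + 1) ^ (β + 1)) := by
        refine setIntegral_mono_on (integrableOn_integral_cube hI3)
          (((integrableOn_integral_cube hI1).add (integrableOn_integral_cube hI2)).const_mul _)
          measurableSet_Ioo fun t ht => ?_
        have ht' := Ioo_subset_Icc_self ht
        have hgr : ∀ x, grad (fun y => m y t + 1) x = grad (fun y => m y t) x := fun x => by
          funext i; simp [grad, pd]
        have hgn := integral_rpow_le_gagliardo hN hβ.le hc (M := fun x => m x t + 1)
          ((h.diff_m t ht).add_const 1) (fun i => by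
            have e : pd i (fun y => m y t + 1) = fun x => grad (fun y => m y t) x i :=
              funext fun x => congrFun (hgr x) i
            rw [e]
            exact (continuous_apply i).comp (h.cont_dm.continuous_slice ht'))
          (fun x => h.one_le_add_one x t)
        simp only [hgr] at hgn
        refine hgn.trans (mul_le_mul_of_nonneg_right ?_ ?_)
        · refine mul_le_mul_of_nonneg_left ?_ (by positivity)
          exact Real.rpow_le_rpow (hint0 c t) (hS t ht') (by positivity)
        · refine add_nonneg (integral_nonneg fun x => ?_) (hint0 _ _)
          exact mul_nonneg (Real.rpow_nonneg (h.add_one_pos x t).le _) (dotp_self_nonneg _)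
    _ = K * (intQ N T (fun x t => (m x t + 1) ^ (β - 1) *
          dotp (grad (fun y => m y t) x) (grad (fun y => m y t) x))
          + intQ N T (fun x t => (m x t + 1) ^ (β + 1))) := by
        rw [integral_const_mul, integral_add (integrableOn_integral_cube hI1)
          (integrableOn_integral_cube hI2), intQ_eq_integral_Ioo hI1, intQ_eq_integral_Ioo hI2]
    _ ≤ _ := mul_le_mul_of_nonneg_left (by linarith) hK0

end FPClassical

lemma ClassicalSol.fpClassical {N : ℕ} {T : ℝ} {G : RN N → ℝ} {fc : RN N → ℝ → ℝ → ℝ}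
    {m₀ uT : RN N → ℝ} {u m : RN N → ℝ → ℝ} (h : ClassicalSol N T G fc m₀ uT u m)
    (hG : Differentiable ℝ (grad G)) (hm : ∀ x t, 0 ≤ m x t) :
    FPClassical N T m fun x t => grad G (grad (fun y => u y t) x) where
  per_m := h.per_m
  per_A t x z := congrArg (grad G) ((h.per_u t).grad x z)
  nonneg := hm
  cont_m := h.cont_m
  cont_mt := h.cont_mt
  cont_dm := continuousOn_pi.2 h.cont_dm
  cont_A := hG.continuous.comp_continuousOn (continuousOn_pi.2 h.cont_du)
  tdiff_m := h.tdiff_m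
  diff_m t ht := (h.xdiff_m t (Ioo_subset_Icc_self ht)).1
  diff_dm t ht := differentiable_pi.2 (h.xdiff_m t (Ioo_subset_Icc_self ht)).2
  diff_A t ht := hG.comp (differentiable_pi.2 (h.xdiff_u t (Ioo_subset_Icc_self ht)).2)
  fkp x t ht := by linarith [h.fkp x t ht]

/-! ### Closing the estimates -/

lemma mul_rpow_mul_sq_le {m a q β l : ℝ} (hm : 0 ≤ m) (ha : 0 ≤ a) (hq : 2 < q) (hl : 0 < l) :
    m * (m + 1) ^ β * a ^ 2
      ≤ l ^ (1 - 2 / q) * (m * a ^ q) + l ^ (-(2 / q)) * (m + 1) ^ (1 + β / (1 - 2 / q)) := by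
  set θ := 2 / q with hθ
  have hθ0 : 0 < θ := by positivity
  have hθ1 : 0 < 1 - θ := by rw [hθ, sub_pos, div_lt_one (by linarith)]; exact hq
  have h1 : 0 < m + 1 := by linarith
  set X := m * a ^ q with hX
  set Z := m * (m + 1) ^ (β / (1 - θ)) with hZ
  have hX0 : 0 ≤ X := by positivity
  have hZ0 : 0 ≤ Z := by positivity
  have hZle : Z ≤ (m + 1) ^ (1 + β / (1 - θ)) := by
    rw [Real.rpow_add h1, Real.rpow_one]
    exact mul_le_mul_of_nonneg_right (by linarith) (by positivity)
  have key := Real.geom_mean_le_arith_mean2_weighted hθ0.le hθ1.le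
    (mul_nonneg (Real.rpow_nonneg hl.le (1 - θ)) hX0)
    (mul_nonneg (Real.rpow_nonneg hl.le (-θ)) hZ0) (by ring)
  have e : (l ^ (1 - θ) * X) ^ θ * (l ^ (-θ) * Z) ^ (1 - θ) = m * (m + 1) ^ β * a ^ 2 := by
    rw [Real.mul_rpow (by positivity) hX0, Real.mul_rpow (by positivity) hZ0, hX, hZ,
      Real.mul_rpow hm (by positivity), Real.mul_rpow hm (by positivity), ← Real.rpow_mul hl.le,
      ← Real.rpow_mul hl.le, ← Real.rpow_mul ha, ← Real.rpow_mul h1.le]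
    have e1 : l ^ ((1 - θ) * θ) * l ^ (-θ * (1 - θ)) = 1 := by
      rw [← Real.rpow_add hl, show (1 - θ) * θ + -θ * (1 - θ) = 0 by ring, Real.rpow_zero]
    have e2 : m ^ θ * m ^ (1 - θ) = m := by
      rw [← Real.rpow_add_of_nonneg hm hθ0.le hθ1.le, add_sub_cancel, Real.rpow_one]
    have e3 : a ^ (q * θ) = a ^ 2 := by
      rw [hθ, mul_div_cancel₀ _ (by linarith : q ≠ 0), Real.rpow_two]
    have e4 : β / (1 - θ) * (1 - θ) = β := div_mul_cancel₀ _ hθ1.ne'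
    rw [e3, e4]
    calc _ = (l ^ ((1 - θ) * θ) * l ^ (-θ * (1 - θ))) * (m ^ θ * m ^ (1 - θ)) * (m + 1) ^ β
            * a ^ 2 := by ring
      _ = _ := by rw [e1, e2, one_mul]
  rw [e] at key
  have h2 : 0 ≤ l ^ (1 - θ) * X := by positivity
  have h3 : l ^ (-θ) * Z ≤ l ^ (-θ) * (m + 1) ^ (1 + β / (1 - θ)) :=
    mul_le_mul_of_nonneg_left hZle (by positivity)
  have h4 : 0 ≤ l ^ (-θ) * Z := by positivity
  nlinarith

lemma rpow_le_mul_rpow_add {M ε a s : ℝ} (hM : 0 < M) (hε : 0 < ε) (ha : 0 ≤ a) (has : a < s) :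
    M ^ a ≤ ε * M ^ s + ((1 / ε) ^ (1 / (s - a))) ^ a := by
  have hsa : 0 < s - a := by linarith
  rcases le_total M ((1 / ε) ^ (1 / (s - a))) with h | h
  · have := Real.rpow_le_rpow hM.le h ha
    have : 0 ≤ ε * M ^ s := by positivity
    linarith
  · have h1 := Real.rpow_le_rpow (by positivity) h hsa.le
    rw [← Real.rpow_mul (by positivity), one_div_mul_cancel hsa.ne', Real.rpow_one,
      div_le_iff₀ hε] at h1
    have h2 : M ^ s = M ^ (s - a) * M ^ a := by rw [← Real.rpow_add hM]; congr 1; ring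
    have h3 : 0 ≤ M ^ a := by positivity
    have h4 : 0 ≤ ((1 / ε) ^ (1 / (s - a))) ^ a := by positivity
    rw [h2]
    nlinarith

lemma le_max_of_le_mul_rpow {X K a b κ τ : ℝ} (hK : 0 ≤ K) (ha : 0 ≤ a) (hb : 0 ≤ b)
    (hκ : 0 ≤ κ) (hτ : 0 ≤ τ) (hκτ : τ * κ < 1) (h : X ≤ K * (a + b * X ^ τ) ^ κ) :
    X ≤ max 1 ((K * (a + b) ^ κ) ^ (1 / (1 - τ * κ))) := by
  rcases le_total X 1 with h1 | h1
  · exact le_max_of_le_left h1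
  refine le_max_of_le_right ?_
  have hX : 0 < X := by linarith
  have hδ : 0 < 1 - τ * κ := by linarith
  have h2 : a + b * X ^ τ ≤ (a + b) * X ^ τ := by
    have := Real.one_le_rpow h1 hτ
    nlinarith
  have h3 : X ≤ K * (a + b) ^ κ * X ^ (τ * κ) := by
    rw [Real.rpow_mul hX.le, mul_assoc, ← Real.mul_rpow (by positivity) (by positivity)]
    exact h.trans (mul_le_mul_of_nonneg_left (Real.rpow_le_rpow (by positivity) h2 hκ) hK)
  have h4 : X ^ (1 - τ * κ) ≤ K * (a + b) ^ κ := by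
    rw [Real.rpow_sub hX, Real.rpow_one, div_le_iff₀ (by positivity)]
    exact h3
  have h5 := Real.rpow_le_rpow (by positivity) h4 (by positivity : 0 ≤ 1 / (1 - τ * κ))
  rwa [← Real.rpow_mul hX.le, mul_one_div_cancel hδ.ne', Real.rpow_one] at h5

lemma le_mul_one_add_of_absorb {X E B p κ r i : ℝ} (hX : 0 ≤ X) (hE : 0 ≤ E) (hp : 0 ≤ p)
    (hκ : 0 ≤ κ) (hr : 0 ≤ r) (h1 : X ≤ p + κ * B) (h2 : B ≤ r * E + i * X) (h3 : κ * i ≤ 1 / 2) :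
    X ≤ (2 * (p + κ * r) + 1) * (1 + E) := by
  have h4 := mul_le_mul_of_nonneg_left h2 hκ
  have h5 := mul_le_mul_of_nonneg_right h3 hX
  have h6 : 0 ≤ κ * r := by positivity
  have h7 : 0 ≤ p * E := by positivity
  linarith

namespace FPClassical

variable {N : ℕ} {T : ℝ} {m : RN N → ℝ → ℝ} {A : RN N → ℝ → RN N}

lemma cont_energy (h : FPClassical N T m A) {q : ℝ} (hq : 0 ≤ q) :
    ContinuousOn (fun x : RN N × ℝ => m x.1 x.2 * euclNorm (A x.1 x.2) ^ q) (univ ×ˢ Icc 0 T) :=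
  h.cont_m.mul (h.cont_euclNorm_A hq)

lemma intQ_energy_nonneg (h : FPClassical N T m A) (q : ℝ) :
    0 ≤ intQ N T (fun x t => m x t * euclNorm (A x t) ^ q) :=
  intQ_nonneg fun _ _ _ => mul_nonneg (h.nonneg _ _) (Real.rpow_nonneg (euclNorm_nonneg _) _)

lemma intQ_rpow_nonneg (h : FPClassical N T m A) (q : ℝ) :
    0 ≤ intQ N T (fun x t => (m x t + 1) ^ q) :=
  intQ_nonneg fun _ _ _ => Real.rpow_nonneg (h.add_one_pos _ _).le _

lemma intQ_drift_le (h : FPClassical N T m A) {q β l : ℝ} (hq : 2 < q) (hl : 0 < l) :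
    intQ N T (fun x t => m x t * (m x t + 1) ^ β * euclNorm (A x t) ^ 2)
      ≤ l ^ (1 - 2 / q) * intQ N T (fun x t => m x t * euclNorm (A x t) ^ q)
        + l ^ (-(2 / q)) * intQ N T (fun x t => (m x t + 1) ^ (1 + β / (1 - 2 / q))) := by
  have h1 := (h.cont_energy (by linarith : 0 ≤ q)).integrableOn_QQ
  have h2 := (h.cont_rpow (1 + β / (1 - 2 / q))).integrableOn_QQ
  calc _ ≤ intQ N T (fun x t => l ^ (1 - 2 / q) * (m x t * euclNorm (A x t) ^ q)
          + l ^ (-(2 / q)) * (m x t + 1) ^ (1 + β / (1 - 2 / q))) :=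
        intQ_mono (h.cont_drift β).integrableOn_QQ ((h1.const_mul _).add (h2.const_mul _))
          fun x _ t _ => mul_rpow_mul_sq_le (h.nonneg x t) (euclNorm_nonneg _) hq hl
    _ = _ := by
        rw [intQ, integral_add (h1.const_mul _) (h2.const_mul _), integral_const_mul,
          integral_const_mul]
        rfl

/-- Uniform bound for `∫_Q m |A|^q` when it is controlled by a subcritical power of `m`. -/
lemma exists_energy_bound (hN : 1 ≤ N) (hT : 0 ≤ T) {q α C₄ : ℝ} (hq : 2 < q) (hα : 0 ≤ α)
    (hαq : α < q / N) (hC : 0 < C₄) (m₀ : RN N → ℝ) (h₀ : ∀ x, 0 ≤ m₀ x) :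
    ∃ C, ∀ m A, FPClassical N T m A → (∀ x, m x 0 = m₀ x) →
      intQ N T (fun x t => m x t * euclNorm (A x t) ^ q)
        ≤ C₄ * (1 + intQ N T (fun x t => (m x t + 1) ^ (α + 1))) →
      intQ N T (fun x t => m x t * euclNorm (A x t) ^ q) ≤ C := by
  have hN0 : (0 : ℝ) < N := by exact_mod_cast hN
  set β := (q - 2) / N with hβ
  have hβ0 : 0 < β := div_pos (by linarith) hN0
  have hq0 : (0 : ℝ) < q := by linarith
  have hq2 : q - 2 ≠ 0 := by linarith
  have hs : 1 + β / (1 - 2 / q) = 1 + q / N := by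
    rw [hβ]; field_simp
  have hs' : β + 1 + 2 * 1 / N = 1 + q / N := by
    rw [hβ]; field_simp; ring
  have hS0 : 0 ≤ ∫ x in cube N, (m₀ x + 1) :=
    setIntegral_nonneg (measurableSet_cube N) fun x _ => by linarith [h₀ x]
  have hy0 : 0 ≤ ∫ x in cube N, (m₀ x + 1) ^ (β + 1) :=
    setIntegral_nonneg (measurableSet_cube N) fun x _ => Real.rpow_nonneg (by linarith [h₀ x]) _
  set y₀ := ∫ x in cube N, (m₀ x + 1) ^ (β + 1)
  set K := (1 + (β + 1 + 1 / N) * N) ^ 2 * (∫ x in cube N, (m₀ x + 1)) ^ (2 / (N : ℝ))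
    * (2 / (β * (β + 1)) + T) with hK
  have hK0 : 0 ≤ K := by positivity
  set κ := K * (β * (β + 1) / 2) with hκ
  have hκ0 : 0 ≤ κ := by positivity
  set l := (2 * κ + 1) ^ (q / 2) with hl
  have hl0 : 0 < l := by positivity
  have hlθ : l ^ (-(2 / q)) = (2 * κ + 1)⁻¹ := by
    rw [hl, ← Real.rpow_mul (by positivity), ← Real.rpow_neg_one]
    congr 1; field_simp
  set C₃ := 2 * (K * y₀ + κ * l ^ (1 - 2 / q)) + 1 with hC₃
  have hC₃0 : 0 < C₃ := by positivity
  set ε := 1 / (2 * C₃ * C₄) with hε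
  have hε0 : 0 < ε := by positivity
  set R := ((1 / ε) ^ (1 / (1 + q / N - (α + 1)))) ^ (α + 1) with hR
  refine ⟨2 * C₄ * (1 + R * T) + 1, fun m A h hm₀ hE => ?_⟩
  have hgain := h.intQ_rpow_le hN hT hβ0 zero_le_one (S := ∫ x in cube N, (m₀ x + 1))
    (fun t ht => by simpa [hm₀] using h.integral_add_one_le ht)
  have hdr := h.intQ_drift_le (β := β) hq hl0
  have hX0 := h.intQ_rpow_nonneg (1 + q / N)
  have hE0 := h.intQ_energy_nonneg q
  rw [hs', ← mul_assoc] at hgain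
  rw [hs, hlθ] at hdr
  simp only [hm₀] at hgain
  set X := intQ N T (fun x t => (m x t + 1) ^ (1 + q / N))
  set E := intQ N T (fun x t => m x t * euclNorm (A x t) ^ q)
  set B := intQ N T (fun x t => m x t * (m x t + 1) ^ β * euclNorm (A x t) ^ 2)
  have h1 : X ≤ K * y₀ + κ * B := by
    refine hgain.trans (le_of_eq ?_)
    rw [hκ, hK]; ring
  have h2 : κ * (2 * κ + 1)⁻¹ ≤ 1 / 2 := by
    rw [← div_eq_mul_inv, div_le_div_iff₀ (by positivity) (by norm_num)]; linarith
  have h3 : X ≤ C₃ * (1 + E) :=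
    le_mul_one_add_of_absorb hX0 hE0 (by positivity) hκ0 (by positivity) h1 hdr h2
  have hI := (h.cont_rpow (1 + q / N)).integrableOn_QQ
  have h4 : intQ N T (fun x t => (m x t + 1) ^ (α + 1)) ≤ ε * X + R * T := by
    calc _ ≤ intQ N T (fun x t => ε * (m x t + 1) ^ (1 + q / N) + R) :=
          intQ_mono (h.cont_rpow _).integrableOn_QQ
            ((continuousOn_const.mul (h.cont_rpow _)).add continuousOn_const).integrableOn_QQ
            fun x _ t _ => rpow_le_mul_rpow_add (h.add_one_pos x t) hε0 (by linarith) (by linarith)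
      _ = _ := by
          rw [intQ, integral_add (hI.const_mul _) continuousOn_const.integrableOn_QQ,
            integral_const_mul, setIntegral_const, volume_real_QQ hT, smul_eq_mul, mul_comm T]
          rfl
  have h5 : C₄ * (ε * X) ≤ (1 + E) / 2 := by
    have h6 : C₄ * (ε * (C₃ * (1 + E))) = (1 + E) / 2 := by
      rw [hε]; field_simp
    rw [← h6]
    gcongr
  have h6 := mul_le_mul_of_nonneg_left h4 hC.le
  linarith

/-- Uniform bound for `∫_Q (m+1)^{(N+2)/(N+2-q)}` in terms of `∫_Q m |A|^q`. -/
lemma exists_rpow_bound (hN : 1 ≤ N) (hT : 0 < T) {q E₀ : ℝ} (hq : 2 < q) (hqN : q < N + 2)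
    (m₀ : RN N → ℝ) (h₀ : ∀ x, 0 ≤ m₀ x) :
    ∃ C, ∀ m A, FPClassical N T m A → (∀ x, m x 0 = m₀ x) →
      intQ N T (fun x t => m x t * euclNorm (A x t) ^ q) ≤ E₀ →
      intQ N T (fun x t => (m x t + 1) ^ (((N : ℝ) + 2) / (N + 2 - q))) ≤ C := by
  have hN0 : (0 : ℝ) < N := by exact_mod_cast hN
  have hd : 0 < (N : ℝ) + 2 - q := by linarith
  set β := (q - 2) / (N + 2 - q) with hβ
  have hβ0 : 0 < β := div_pos (by linarith) hd
  have hq0 : (0 : ℝ) < q := by linarith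
  have hq2 : q - 2 ≠ 0 := by linarith
  have hs : 1 + β / (1 - 2 / q) = ((N : ℝ) + 2) / (N + 2 - q) := by
    rw [hβ]; field_simp; ring
  have hs' : β + 1 + 2 * (β + 1) / N = ((N : ℝ) + 2) / (N + 2 - q) := by
    rw [hβ]; field_simp; ring
  have hy0 : 0 ≤ ∫ x in cube N, (m₀ x + 1) ^ (β + 1) :=
    setIntegral_nonneg (measurableSet_cube N) fun x _ => Real.rpow_nonneg (by linarith [h₀ x]) _
  set y₀ := ∫ x in cube N, (m₀ x + 1) ^ (β + 1)
  set K := (1 + (β + 1 + (β + 1) / N) * N) ^ 2 * (2 / (β * (β + 1)) + T) with hK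
  have hK0 : 0 ≤ K := by positivity
  refine ⟨_, fun m A h hm₀ hE => le_max_of_le_mul_rpow (K := K) (a := y₀)
    (b := β * (β + 1) / 2 * (max E₀ 0 + 1)) (κ := 1 + 2 / N) (τ := 1 - 2 / q) hK0 hy0
    (by positivity) (by positivity) ?_ ?_ ?_⟩
  · rw [sub_nonneg, div_le_one hq0]; exact hq.le
  · have : (1 - 2 / q) * (1 + 2 / N) = 1 - 2 * (N + 2 - q) / (q * N) := by field_simp; ring
    rw [this]
    have : 0 < 2 * ((N : ℝ) + 2 - q) / (q * N) := by positivity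
    linarith
  have hX0 : 0 < intQ N T (fun x t => (m x t + 1) ^ (((N : ℝ) + 2) / (N + 2 - q))) := by
    refine hT.trans_le ?_
    calc T = intQ N T (fun _ _ => 1) := by
          rw [intQ, setIntegral_const, volume_real_QQ hT.le, smul_eq_mul, mul_one]
      _ ≤ _ := intQ_mono continuousOn_const.integrableOn_QQ (h.cont_rpow _).integrableOn_QQ
          fun x _ t _ => Real.one_le_rpow (h.one_le_add_one x t) (by positivity)
  have hdr := h.intQ_drift_le (β := β) hq hX0
  rw [hs] at hdr
  set Y := y₀ + β * (β + 1) / 2 * intQ N T (fun x t => m x t * (m x t + 1) ^ β *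
    euclNorm (A x t) ^ 2) with hY
  have hgain := h.intQ_rpow_le hN hT.le hβ0 (by linarith : 0 ≤ β + 1) (S := Y)
    (fun t ht => by simpa [hm₀] using h.integral_rpow_le hβ0.le ht)
  rw [hs'] at hgain
  simp only [hm₀] at hgain
  set X := intQ N T (fun x t => (m x t + 1) ^ (((N : ℝ) + 2) / (N + 2 - q)))
  have hXX : X ^ (-(2 / q)) * X = X ^ (1 - 2 / q) := by
    rw [← Real.rpow_add_one hX0.ne']; congr 1; ring
  rw [hXX] at hdr
  have hB0 : 0 ≤ intQ N T (fun x t => m x t * (m x t + 1) ^ β * euclNorm (A x t) ^ 2) :=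
    intQ_nonneg fun x s _ => by
      have := h.nonneg x s
      have := h.add_one_pos x s
      positivity
  have hY0 : 0 ≤ Y := by positivity
  have hYle : Y ≤ y₀ + β * (β + 1) / 2 * (max E₀ 0 + 1) * X ^ (1 - 2 / q) := by
    have h1 : X ^ (1 - 2 / q) * intQ N T (fun x t => m x t * euclNorm (A x t) ^ q)
        ≤ X ^ (1 - 2 / q) * max E₀ 0 :=
      mul_le_mul_of_nonneg_left (hE.trans (le_max_left _ _)) (by positivity)
    rw [hY, mul_assoc (β * (β + 1) / 2)]
    gcongr
    linarith
  calc X ≤ K * Y ^ (1 + 2 / (N : ℝ)) := by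
        refine hgain.trans (le_of_eq ?_)
        rw [Real.rpow_add_of_nonneg hY0 (by positivity) (by positivity), Real.rpow_one, hK]
        ring
    _ ≤ _ := by gcongr

end FPClassical

/-! ### A stationary competitor -/

lemma contDiff_pd_slice {N : ℕ} {φ : RN N → ℝ → ℝ}
    (h : ContDiff ℝ (⊤ : ℕ∞) fun q : RN N × ℝ => φ q.1 q.2) (i : Fin N) :
    ContDiff ℝ (⊤ : ℕ∞) fun q : RN N × ℝ => pd i (fun y => φ y q.2) q.1 := by
  have e : (fun q : RN N × ℝ => pd i (fun y => φ y q.2) q.1)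
      = fun q => fderiv ℝ (fun q : RN N × ℝ => φ q.1 q.2) q (Pi.single i 1, 0) := by
    funext q
    have h1 : HasFDerivAt (fun y : RN N => (y, q.2)) (ContinuousLinearMap.inl ℝ (RN N) ℝ) q.1 :=
      hasFDerivAt_prodMk_left q.1 q.2
    have h2 := ((h.differentiable (by simp)) (q.1, q.2)).hasFDerivAt.comp q.1 h1
    exact congrArg (fun l => l (Pi.single i 1)) h2.fderiv
  rw [e]
  exact (h.fderiv_right (m := (⊤ : ℕ∞)) (by simp)).clm_apply contDiff_const

lemma hasDerivAt_slice {N : ℕ} {φ : RN N → ℝ → ℝ}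
    (h : ContDiff ℝ (⊤ : ℕ∞) fun q : RN N × ℝ => φ q.1 q.2) (x : RN N) (t : ℝ) :
    HasDerivAt (φ x) (fderiv ℝ (fun q : RN N × ℝ => φ q.1 q.2) (x, t) (0, 1)) t :=
  ((h.differentiable (by simp)) (x, t)).hasFDerivAt.comp_hasDerivAt t
    ((hasDerivAt_const t x).prodMk (hasDerivAt_id t))

lemma memK_stationary {N : ℕ} {T α γ' : ℝ} (hT : 0 ≤ T) (hα : 0 ≤ α) (hγ' : 0 ≤ γ')
    {m₀ : RN N → ℝ} (hreg : ContDiff ℝ 2 m₀) (hper : ZPeriodic m₀) (hpos : ∀ x, 0 < m₀ x) :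
    MemK N T α γ' m₀ (fun x _ => m₀ x) fun x _ => grad m₀ x := by
  have hc := hreg.continuous
  have hg1 : ContDiff ℝ 1 (grad m₀) := contDiff_grad hreg (by norm_num)
  have hgc := hg1.continuous
  have hQ : ∀ {E : Type} [NormedAddCommGroup E] {k : RN N × ℝ → E}, Continuous k →
      IntegrableOn k (QQ N T) := fun hk => hk.continuousOn.integrableOn_QQ
  have htrace : ∀ φ : RN N → ℝ → ℝ, IsTest N φ →
      intQ N T (fun x t => m₀ x * deriv (φ x) t + dotp (grad m₀ x) (grad (fun y => φ y t) x)
        + m₀ x * lap (fun y => φ y t) x)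
      + (∫ x in cube N, m₀ x * φ x 0) - (∫ x in cube N, m₀ x * φ x T) = 0 := by
    intro φ hφ
    have hφc := hφ.1.continuous
    have hpd := contDiff_pd_slice hφ.1
    have hpd2 : ∀ i, Continuous fun q : RN N × ℝ => pd i (pd i fun y => φ y q.2) q.1 := fun i =>
      (contDiff_pd_slice (φ := fun x t => pd i (fun y => φ y t) x) (hpd i) i).continuous
    have hgφ : Continuous fun q : RN N × ℝ => grad (fun y => φ y q.2) q.1 :=
      continuous_pi fun i => (hpd i).continuous
    have hlap : Continuous fun q : RN N × ℝ => lap (fun y => φ y q.2) q.1 :=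
      continuous_finsetSum _ fun i _ => hpd2 i
    have hder : ∀ x t, deriv (φ x) t
        = fderiv ℝ (fun q : RN N × ℝ => φ q.1 q.2) (x, t) (0, 1) :=
      fun x t => (hasDerivAt_slice hφ.1 x t).deriv
    have hdt : Continuous fun q : RN N × ℝ => deriv (φ q.1) q.2 := by
      simp only [hder]
      exact (hφ.1.continuous_fderiv (by simp)).clm_apply continuous_const
    have hm : Continuous fun q : RN N × ℝ => m₀ q.1 := hc.comp continuous_fst
    have hgm : Continuous fun q : RN N × ℝ => grad m₀ q.1 := hgc.comp continuous_fst
    have hI1 := hQ (hm.mul hdt)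
    have hcd : Continuous fun q : RN N × ℝ => dotp (grad m₀ q.1) (grad (fun y => φ y q.2) q.1)
        + m₀ q.1 * lap (fun y => φ y q.2) q.1 :=
      (continuous_dotp.comp (hgm.prodMk hgφ)).add (hm.mul hlap)
    have h1 := integral_cube_sub_eq_intQ_deriv hT (g := fun x t => m₀ x * φ x t)
      (g' := fun x t => m₀ x * deriv (φ x) t) (hm.mul hφc).continuousOn (hm.mul hdt).continuousOn
      fun x t _ => by
        rw [hder]
        exact (hasDerivAt_slice hφ.1 x t).const_mul _
    have h2 : intQ N T (fun x t => dotp (grad m₀ x) (grad (fun y => φ y t) x)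
        + m₀ x * lap (fun y => φ y t) x) = 0 := by
      rw [intQ_eq_integral_Ioo (hQ hcd)]
      have hz : ∀ t, ∫ x in cube N, (dotp (grad m₀ x) (grad (fun y => φ y t) x)
          + m₀ x * lap (fun y => φ y t) x) = 0 := by
        intro t
        have hφt : Differentiable ℝ (grad fun y => φ y t) := differentiable_pi.2 fun i =>
          ((hpd i).comp (contDiff_prodMk_left t)).differentiable (by simp)
        have hmd := hreg.differentiable (by norm_num)
        have e : dive (fun y => m₀ y • grad (fun y => φ y t) y)
            = fun x => dotp (grad m₀ x) (grad (fun y => φ y t) x)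
              + m₀ x * lap (fun y => φ y t) x := by
          funext x
          rw [dive_smul (hmd x) (hφt x), dive_grad, add_comm]
        rw [← e]
        refine integral_cube_dive_eq_zero (hmd.smul hφt) (fun x z => ?_) ?_
        · rw [hper x z, (hφ.2 t).grad x z]
        · rw [e]
          exact (hcd.comp (by fun_prop : Continuous fun x : RN N => (x, t))).integrableOn_cube
      simp [hz]
    have h3 : intQ N T (fun x t => m₀ x * deriv (φ x) t
        + dotp (grad m₀ x) (grad (fun y => φ y t) x) + m₀ x * lap (fun y => φ y t) x)
        = intQ N T (fun x t => m₀ x * deriv (φ x) t)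
          + intQ N T (fun x t => dotp (grad m₀ x) (grad (fun y => φ y t) x)
            + m₀ x * lap (fun y => φ y t) x) := by
      simp only [add_assoc]
      exact integral_add hI1 (hQ hcd)
    rw [h3, h2, ← h1]
    ring
  refine ⟨fun _ => hper, fun _ => hper.grad, fun x _ => (hpos x).le, ?_, ?_, ?_, ?_, ?_, ?_, htrace⟩
  · exact hQ ((hc.comp continuous_fst).rpow_const fun _ => Or.inr (by linarith))
  · exact hQ (hgc.comp continuous_fst)
  · exact Eventually.of_forall fun q h => absurd h (hpos q.1).ne'
  · simp only [kinQ, hpos, if_true]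
    exact hQ (((continuous_euclNorm.comp (hgc.comp continuous_fst)).rpow_const fun _ =>
      Or.inr hγ').mul ((hc.comp continuous_fst).rpow_const fun q => Or.inl (hpos q.1).ne'))
  · exact hc.integrableOn_cube
  · intro φ hφ h0
    have := htrace φ hφ
    simpa [h0] using this

/-! ### Bounds on the energy -/

lemma intQ_le_of_le {N : ℕ} {T C : ℝ} (hT : 0 ≤ T) (hC : 0 ≤ C) {k : RN N → ℝ → ℝ}
    (h : ∀ x ∈ cube N, ∀ t ∈ Ioo 0 T, k x t ≤ C) : intQ N T k ≤ T * C := by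
  by_cases hk : IntegrableOn (fun q : RN N × ℝ => k q.1 q.2) (QQ N T)
  · calc intQ N T k ≤ intQ N T fun _ _ => C :=
          intQ_mono hk continuousOn_const.integrableOn_QQ h
      _ = T * C := by rw [intQ, setIntegral_const, volume_real_QQ hT, smul_eq_mul]
  · rw [intQ, integral_undef hk]
    positivity

lemma Fint_nonneg {N : ℕ} {f : RN N → ℝ → ℝ} (hf : ∀ x s, 0 ≤ s → 0 ≤ f x s) (x : RN N) {s : ℝ}
    (hs : 0 ≤ s) : 0 ≤ Fint f x s :=
  intervalIntegral.integral_nonneg hs fun σ hσ => hf x σ hσ.1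

lemma continuousOn_Fint {N : ℕ} {f : RN N → ℝ → ℝ}
    (hf : ContinuousOn (fun q : RN N × ℝ => f q.1 q.2) ((univ : Set (RN N)) ×ˢ Ici (0 : ℝ))) :
    ContinuousOn (fun q : RN N × ℝ => Fint f q.1 q.2) ((univ : Set (RN N)) ×ˢ Ici (0 : ℝ)) := by
  have h1 : Continuous fun q : (RN N × ℝ) × ℝ => f q.1.1 (max q.2 0) :=
    hf.comp_continuous (f := fun q : (RN N × ℝ) × ℝ => (q.1.1, max q.2 0)) (by fun_prop)
      fun q => ⟨mem_univ _, mem_Ici.2 (le_max_right _ _)⟩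
  have h2 : Continuous fun q : RN N × ℝ => ∫ σ in (0 : ℝ)..q.2, f q.1 (max σ 0) :=
    intervalIntegral.continuous_parametric_intervalIntegral_of_continuous
      (f := fun (q : RN N × ℝ) σ => f q.1 (max σ 0)) h1 continuous_snd
  refine h2.continuousOn.congr fun q hq => ?_
  refine intervalIntegral.integral_congr fun σ hσ => ?_
  have hq0 : (0 : ℝ) ≤ q.2 := hq.2
  rw [uIcc_of_le hq0] at hσ
  simp only [max_eq_left hσ.1]

lemma le_add_mul_rpow {g g' : ℝ → ℝ} {c α : ℝ} (hα : 0 < α)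
    (hg : ∀ s, 0 ≤ s → HasDerivAt g (g' s) s)
    (hb : ∀ s, 0 ≤ s → |g' s| ≤ c * (s + 1) ^ (α - 1)) {s : ℝ} (hs : 0 ≤ s) :
    g s ≤ g 0 + c / α * (s + 1) ^ α := by
  have hc : 0 ≤ c := by
    have := (abs_nonneg _).trans (hb 0 le_rfl)
    simpa using this
  have hd : ∀ s, 0 ≤ s → HasDerivAt (fun s => g s - c / α * (s + 1) ^ α)
      (g' s - c * (s + 1) ^ (α - 1)) s := fun s hs => by
    have h1 := (((hasDerivAt_id s).add_const 1).rpow_const (p := α)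
      (Or.inl (by simp only [id]; linarith))).const_mul (c / α)
    refine ((hg s hs).sub h1).congr_deriv ?_
    simp only [id]
    field_simp
  have hanti : AntitoneOn (fun s => g s - c / α * (s + 1) ^ α) (Ici 0) := by
    refine antitoneOn_of_deriv_nonpos (convex_Ici 0)
      (fun s hs => (hd s hs).continuousAt.continuousWithinAt)
      (fun s hs => (hd s (interior_subset hs)).differentiableAt.differentiableWithinAt)
      fun s hs => ?_
    rw [(hd s (interior_subset hs)).deriv]
    linarith [(le_abs_self _).trans (hb s (interior_subset hs))]
  have := hanti (mem_Ici.2 le_rfl) (mem_Ici.2 hs) hs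
  simp only [zero_add, Real.one_rpow] at this
  have : 0 ≤ c / α := by positivity
  linarith

lemma exists_Fint_le {N : ℕ} {f f' : RN N → ℝ → ℝ} {c α : ℝ} (hα : 0 < α)
    (hfc : ContinuousOn (fun q : RN N × ℝ => f q.1 q.2) ((univ : Set (RN N)) ×ˢ Ici (0 : ℝ)))
    (hf : ∀ x s, 0 ≤ s → 0 ≤ f x s)
    (hfd : ∀ x s, 0 ≤ s → HasDerivAt (f x) (f' x s) s)
    (hfb : ∀ x s, 0 ≤ s → |f' x s| ≤ c * (s + 1) ^ (α - 1)) :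
    ∃ C, 0 ≤ C ∧ ∀ x ∈ cube N, ∀ s, 0 ≤ s → Fint f x s ≤ C * (s + 1) ^ (α + 1) := by
  have hc : 0 ≤ c := by
    have := (abs_nonneg _).trans (hfb 0 0 le_rfl)
    simpa using this
  obtain ⟨C₀, hC₀⟩ := (isCompact_cube N).exists_bound_of_continuousOn (f := fun x => f x 0)
    (hfc.comp_continuous (f := fun x : RN N => (x, (0 : ℝ))) (by fun_prop)
      fun x => ⟨mem_univ _, self_mem_Ici⟩).continuousOn
  have hb0 : 0 ≤ max C₀ 0 + c / α := by positivity
  refine ⟨max C₀ 0 + c / α, hb0, fun x hx s hs => ?_⟩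
  have h1 : ∀ σ ∈ uIoc 0 s, ‖f x σ‖ ≤ (max C₀ 0 + c / α) * (s + 1) ^ α := by
    intro σ hσ
    rw [uIoc_of_le hs] at hσ
    rw [Real.norm_of_nonneg (hf x σ hσ.1.le)]
    have h2 := le_add_mul_rpow hα (hfd x) (hfb x) hσ.1.le
    have h3 : f x 0 ≤ max C₀ 0 := (le_abs_self _).trans ((hC₀ x hx).trans (le_max_left _ _))
    have h4 : 1 ≤ (s + 1) ^ α := Real.one_le_rpow (by linarith) hα.le
    have h5 : (σ + 1) ^ α ≤ (s + 1) ^ α :=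
      Real.rpow_le_rpow (by linarith [hσ.1]) (by linarith [hσ.2]) hα.le
    have h6 := mul_le_mul_of_nonneg_left h5 (by positivity : 0 ≤ c / α)
    have h7 := mul_le_mul_of_nonneg_left h4 (le_max_right C₀ 0)
    linarith
  have h2 := (le_abs_self _).trans (intervalIntegral.norm_integral_le_of_norm_le_const h1)
  refine h2.trans ?_
  have hs1 : 0 < s + 1 := by linarith
  rw [sub_zero, abs_of_nonneg hs, Real.rpow_add_one hs1.ne', mul_assoc]
  gcongr
  linarith

lemma exists_energy_competitor_le {N : ℕ} {T : ℝ} (hT : 0 ≤ T) {L : RN N → ℝ} (hL : Continuous L)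
    {f : RN N → ℝ → ℝ} (hf : ∀ x s, 0 ≤ s → 0 ≤ f x s) {m₀ : RN N → ℝ} (hreg : ContDiff ℝ 2 m₀)
    (hpos : ∀ x, 0 < m₀ x) (uT : RN N → ℝ) :
    ∃ C, 0 ≤ C ∧ ∀ η ∈ Ioc (0 : ℝ) 1,
      energyF N T (Lpen L η) (Fint f) uT (fun x _ => m₀ x) (fun x _ => grad m₀ x) ≤ C := by
  have hc := hreg.continuous
  have hgc : Continuous (grad m₀) := (contDiff_grad (m := 1) hreg (by norm_num)).continuous
  have hqc : Continuous fun x => (-(m₀ x)⁻¹) • grad m₀ x :=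
    (hc.inv₀ fun x => (hpos x).ne').neg.smul hgc
  have hN3 : (0 : ℝ) < N + 3 := by positivity
  have hbc : Continuous fun x => m₀ x * (L ((-(m₀ x)⁻¹) • grad m₀ x)
      + euclNorm ((-(m₀ x)⁻¹) • grad m₀ x) ^ ((N : ℝ) + 3)) :=
    hc.mul ((hL.comp hqc).add ((continuous_euclNorm.comp hqc).rpow_const fun _ => Or.inr hN3.le))
  obtain ⟨C₁, hC₁⟩ := (isCompact_cube N).exists_bound_of_continuousOn hbc.continuousOn
  refine ⟨T * max C₁ 0 + |∫ x in cube N, uT x * m₀ x|, by positivity, fun η hη => ?_⟩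
  refine add_le_add (intQ_le_of_le hT (le_max_right _ _) fun x hx t _ => ?_) (le_abs_self _)
  rw [mLag, if_pos (hpos x), Lpen]
  have h1 := Fint_nonneg hf x (hpos x).le
  have h2 := (le_abs_self _).trans ((hC₁ x hx).trans (le_max_left _ 0))
  have h3 : η / ((N : ℝ) + 3) ≤ 1 := by
    rw [div_le_one hN3]; linarith [hη.2, (Nat.cast_nonneg N : (0 : ℝ) ≤ N)]
  have h4 : 0 ≤ euclNorm ((-(m₀ x)⁻¹) • grad m₀ x) ^ ((N : ℝ) + 3) :=
    Real.rpow_nonneg (euclNorm_nonneg _) _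
  have h5 := mul_le_mul_of_nonneg_left
    (add_le_add_right (mul_le_of_le_one_left h4 h3) (L ((-(m₀ x)⁻¹) • grad m₀ x))) (hpos x).le
  linarith

/-! ### Energy bound for minimisers and conclusion -/

lemma mLag_neg_smul {N : ℕ} (L : RN N → ℝ) {s : ℝ} (hs : 0 ≤ s) (a : RN N) :
    mLag L s (-s • a) = s * L a := by
  rcases hs.eq_or_lt with rfl | hs
  · simp [mLag]
  · rw [mLag, if_pos hs, smul_smul, neg_mul_neg, inv_mul_cancel₀ hs.ne', one_smul]

namespace FPClassical

variable {N : ℕ} {T : ℝ} {m : RN N → ℝ → ℝ} {A : RN N → ℝ → RN N}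

lemma integral_le_integral_init (h : FPClassical N T m A) {t : ℝ} (ht : t ∈ Icc 0 T) :
    ∫ x in cube N, m x t ≤ ∫ x in cube N, (m x 0 + 1) := by
  have hc := h.cont_m.continuous_slice ht
  refine le_trans ?_ (h.integral_add_one_le ht)
  exact setIntegral_mono hc.integrableOn_cube (hc.add continuous_const).integrableOn_cube
    fun x => (lt_add_one _).le

lemma intQ_le_mul_integral_init (h : FPClassical N T m A) (hT : 0 ≤ T) :
    intQ N T m ≤ T * ∫ x in cube N, (m x 0 + 1) := by
  have hi := h.cont_m.integrableOn_QQ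
  rw [intQ_eq_integral_Ioo hi]
  calc ∫ t in Ioo 0 T, ∫ x in cube N, m x t
      ≤ ∫ _ in Ioo 0 T, ∫ x in cube N, (m x 0 + 1) :=
        setIntegral_mono_on (integrableOn_integral_cube hi) (integrableOn_const (by simp))
          measurableSet_Ioo fun t ht => h.integral_le_integral_init (Ioo_subset_Icc_self ht)
    _ = T * ∫ x in cube N, (m x 0 + 1) := by simp [hT]

lemma abs_integral_mul_le (h : FPClassical N T m A) {g : RN N → ℝ} (hg : Continuous g) {U : ℝ}
    (hU : ∀ x ∈ cube N, ‖g x‖ ≤ U) (hU0 : 0 ≤ U) {t : ℝ} (ht : t ∈ Icc 0 T) :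
    |∫ x in cube N, g x * m x t| ≤ U * ∫ x in cube N, (m x 0 + 1) := by
  have hc := h.cont_m.continuous_slice ht
  calc |∫ x in cube N, g x * m x t| ≤ ∫ x in cube N, |g x * m x t| := abs_integral_le_integral_abs
    _ ≤ ∫ x in cube N, U * m x t := by
        refine setIntegral_mono_on (hg.mul hc).abs.integrableOn_cube
          (hc.const_smul U).integrableOn_cube (measurableSet_cube N) fun x hx => ?_
        rw [abs_mul, abs_of_nonneg (h.nonneg x t)]
        exact mul_le_mul_of_nonneg_right (hU x hx) (h.nonneg x t)
    _ ≤ _ := by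
        rw [integral_const_mul]
        exact mul_le_mul_of_nonneg_left (h.integral_le_integral_init ht) hU0

lemma cont_Fint (h : FPClassical N T m A) {f : RN N → ℝ → ℝ}
    (hf : ContinuousOn (fun q : RN N × ℝ => f q.1 q.2) ((univ : Set (RN N)) ×ˢ Ici (0 : ℝ))) :
    ContinuousOn (fun q : RN N × ℝ => Fint f q.1 (m q.1 q.2)) (univ ×ˢ Icc 0 T) :=
  (continuousOn_Fint hf).comp (continuousOn_fst.prodMk h.cont_m)
    fun q _ => ⟨mem_univ _, h.nonneg q.1 q.2⟩

lemma energyF_eq (h : FPClassical N T m A) {L : RN N → ℝ} (hL : Continuous L)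
    {f : RN N → ℝ → ℝ}
    (hf : ContinuousOn (fun q : RN N × ℝ => f q.1 q.2) ((univ : Set (RN N)) ×ˢ Ici (0 : ℝ)))
    (uT : RN N → ℝ) :
    energyF N T L (Fint f) uT m (fun x t => -(m x t) • A x t)
      = intQ N T (fun x t => m x t * L (A x t)) - intQ N T (fun x t => Fint f x (m x t))
        + ∫ x in cube N, uT x * m x T := by
  simp only [energyF, mLag_neg_smul L (h.nonneg _ _)]
  congr 1
  exact integral_sub (h.cont_m.mul (hL.comp_continuousOn h.cont_A)).integrableOn_QQ
    (h.cont_Fint hf).integrableOn_QQ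

end FPClassical

lemma exists_energy_le_of_minimisesE {N : ℕ} {T α γ' K c : ℝ} (hT : 0 ≤ T) (hα : 0 < α)
    (hγ' : 0 ≤ γ') (hK : 0 < K) {L : RN N → ℝ} (hL : Continuous L)
    (hLlow : ∀ q, K⁻¹ * euclNorm q ^ γ' - K ≤ L q) {f f' : RN N → ℝ → ℝ}
    (hfc : ContinuousOn (fun q : RN N × ℝ => f q.1 q.2) ((univ : Set (RN N)) ×ˢ Ici (0 : ℝ)))
    (hf : ∀ x s, 0 ≤ s → 0 ≤ f x s)
    (hfd : ∀ x s, 0 ≤ s → HasDerivAt (f x) (f' x s) s)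
    (hfb : ∀ x s, 0 ≤ s → |f' x s| ≤ c * (s + 1) ^ (α - 1))
    {m₀ uT : RN N → ℝ} (hreg : ContDiff ℝ 2 m₀) (hper : ZPeriodic m₀) (hpos : ∀ x, 0 < m₀ x)
    (huT : Continuous uT) :
    ∃ C > 0, ∀ η ∈ Ioc (0 : ℝ) 1, ∀ m A, FPClassical N T m A → (∀ x, m x 0 = m₀ x) →
      MinimisesE N T α γ' m₀ (Lpen L η) (Fint f) uT m (fun x t => -(m x t) • A x t) →
      intQ N T (fun x t => m x t * euclNorm (A x t) ^ γ')
        ≤ C * (1 + intQ N T (fun x t => (m x t + 1) ^ (α + 1))) := by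
  obtain ⟨C₁, hC₁0, hC₁⟩ := exists_energy_competitor_le hT hL hf hreg hpos uT
  obtain ⟨C₂, hC₂0, hC₂⟩ := exists_Fint_le hα hfc hf hfd hfb
  obtain ⟨U, hU⟩ := (isCompact_cube N).exists_bound_of_continuousOn huT.continuousOn
  set S := ∫ x in cube N, (m₀ x + 1)
  have hS : 0 ≤ S := integral_nonneg fun x => add_nonneg (hpos x).le zero_le_one
  have hC0 : 0 ≤ C₁ + max U 0 * S := by positivity
  refine ⟨K * (C₂ + K + (C₁ + max U 0 * S)), by positivity, fun η hη m A h h₀ hmin => ?_⟩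
  have hle := hmin.2 _ _ (memK_stationary hT hα.le hγ' hreg hper hpos)
  rw [h.energyF_eq (continuous_Lpen hL) hfc] at hle
  replace hle := hle.trans (hC₁ η hη)
  have hfin := neg_le_of_abs_le (h.abs_integral_mul_le huT
    (fun x hx => (hU x hx).trans (le_max_left U 0)) (le_max_right _ _) (right_mem_Icc.2 hT))
  simp only [h₀] at hfin
  have hX := (h.cont_rpow (α + 1)).integrableOn_QQ
  have hE := (h.cont_energy hγ').integrableOn_QQ
  have hF : intQ N T (fun x t => Fint f x (m x t))
      ≤ C₂ * intQ N T (fun x t => (m x t + 1) ^ (α + 1)) := by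
    refine (intQ_mono (l := fun x t => C₂ * (m x t + 1) ^ (α + 1))
      (h.cont_Fint hfc).integrableOn_QQ (hX.const_mul C₂)
      fun x hx t _ => hC₂ x hx _ (h.nonneg x t)).trans_eq ?_
    exact integral_const_mul _ _
  have hlow : K⁻¹ * intQ N T (fun x t => m x t * euclNorm (A x t) ^ γ')
      - K * intQ N T (fun x t => (m x t + 1) ^ (α + 1))
      ≤ intQ N T (fun x t => m x t * Lpen L η (A x t)) := by
    have e : intQ N T (fun x t => K⁻¹ * (m x t * euclNorm (A x t) ^ γ')
        - K * (m x t + 1) ^ (α + 1)) = K⁻¹ * intQ N T (fun x t => m x t * euclNorm (A x t) ^ γ')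
      - K * intQ N T (fun x t => (m x t + 1) ^ (α + 1)) := by
      simp only [intQ]
      rw [integral_sub (hE.const_mul _) (hX.const_mul _), integral_const_mul, integral_const_mul]
    rw [← e]
    refine intQ_mono ((hE.const_mul _).sub (hX.const_mul _))
      (h.cont_m.mul ((continuous_Lpen hL).comp_continuousOn h.cont_A)).integrableOn_QQ
      fun x _ t _ => ?_
    have hm := h.nonneg x t
    have h1 : m x t ≤ (m x t + 1) ^ (α + 1) := by
      have := Real.rpow_le_rpow_of_exponent_le (h.one_le_add_one x t) (by linarith : 1 ≤ α + 1)
      rw [Real.rpow_one] at this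
      linarith
    have h2 : L (A x t) ≤ Lpen L η (A x t) :=
      le_add_of_nonneg_right (mul_nonneg (div_nonneg hη.1.le (by positivity))
        (Real.rpow_nonneg (euclNorm_nonneg _) _))
    have h3 := mul_le_mul_of_nonneg_left ((hLlow (A x t)).trans h2) hm
    have h4 := mul_le_mul_of_nonneg_left h1 hK.le
    linarith
  have hX0 := h.intQ_rpow_nonneg (α + 1)
  set X := intQ N T (fun x t => (m x t + 1) ^ (α + 1))
  set E := intQ N T (fun x t => m x t * euclNorm (A x t) ^ γ')
  have hfinal : K⁻¹ * E ≤ (C₂ + K) * X + (C₁ + max U 0 * S) := by linarith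
  rw [inv_mul_le_iff₀ hK] at hfinal
  refine hfinal.trans ?_
  rw [mul_assoc]
  refine mul_le_mul_of_nonneg_left ?_ hK.le
  nlinarith [mul_nonneg hC0 hX0, mul_nonneg hC₂0 hX0]

lemma exists_exponent {N q p : ℝ} (hN : 1 ≤ N) (hq : 2 < q) (hqN : q ≤ N + 2) (hp : 1 ≤ p)
    (h : q < N + 2 → p < (N + 2) / (N + 2 - q)) :
    ∃ r, 2 < r ∧ r ≤ q ∧ r < N + 2 ∧ p ≤ (N + 2) / (N + 2 - r) := by
  rcases hqN.lt_or_eq with hlt | rfl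
  · exact ⟨q, hq, le_rfl, hlt, (h hlt).le⟩
  have hd : 0 < min (N / 2) ((N + 2) / p) := lt_min (by linarith) (by positivity)
  refine ⟨N + 2 - min (N / 2) ((N + 2) / p), by linarith [min_le_left (N / 2) ((N + 2) / p)],
    by linarith, by linarith, ?_⟩
  rw [sub_sub_cancel, le_div_comm₀ (by linarith) hd]
  exact min_le_right _ _

lemma FPClassical.intQ_energy_le {N : ℕ} {T : ℝ} {m : RN N → ℝ → ℝ} {A : RN N → ℝ → RN N}
    (h : FPClassical N T m A) (hT : 0 ≤ T) {r q : ℝ} (hr : 0 ≤ r) (hrq : r ≤ q) :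
    intQ N T (fun x t => m x t * euclNorm (A x t) ^ r)
      ≤ T * (∫ x in cube N, (m x 0 + 1))
        + intQ N T (fun x t => m x t * euclNorm (A x t) ^ q) := by
  have h1 := h.cont_m.integrableOn_QQ
  have h2 := (h.cont_energy (hr.trans hrq)).integrableOn_QQ
  refine (intQ_mono (l := fun x t => m x t + m x t * euclNorm (A x t) ^ q)
    (h.cont_energy hr).integrableOn_QQ (h1.add h2) fun x _ t _ => ?_).trans ?_
  · have ha := euclNorm_nonneg (A x t)
    have : euclNorm (A x t) ^ r ≤ 1 + euclNorm (A x t) ^ q := by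
      rcases le_total (euclNorm (A x t)) 1 with hle | hle
      · linarith [Real.rpow_le_one ha hle hr, Real.rpow_nonneg ha q]
      · linarith [Real.rpow_le_rpow_of_exponent_le hle hrq]
    linarith [mul_le_mul_of_nonneg_left this (h.nonneg x t)]
  · exact (integral_add h1 h2).trans_le (add_le_add_left (h.intQ_le_mul_integral_init hT) _)

/-- **Lemma 3.6**: uniform `L^p` bounds, independent of the penalisation parameter
`η ∈ (0,1]`, for the minimising solutions of the penalised MFG systems. -/
theorem penalised_Lp_bound (N : ℕ) (hN : 1 ≤ N) (T : ℝ) (hT : 0 < T)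
    (γ γ' C_H C_L c_f α : ℝ)
    (H : RN N → ℝ) (f f' : RN N → ℝ → ℝ) (m₀ uT : RN N → ℝ)
    (hγ : 1 < γ) (hγ' : γ' = γ / (γ - 1))
    (hCH : 0 < C_H) (hHconv : ConvexOn ℝ Set.univ H) (hHreg : ContDiff ℝ 3 H)
    (hHgrowth : ∀ p, C_H⁻¹ * euclNorm p ^ γ ≤ H p ∧ H p ≤ C_H * (euclNorm p ^ γ + 1))
    (hCL : 0 < C_L)
    (hLgrowth : ∀ q, C_L⁻¹ * euclNorm q ^ γ' - C_L ≤ Leg H q ∧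
      Leg H q ≤ C_L * (euclNorm q ^ γ' + 1))
    (hα : 0 < α) (hcf : 0 < c_f)
    (hfcont : ContinuousOn (fun q : RN N × ℝ => f q.1 q.2)
      ((Set.univ : Set (RN N)) ×ˢ Ici (0:ℝ)))
    (hfper : ∀ s, ZPeriodic fun x => f x s)
    (hfnn : ∀ x s, 0 ≤ s → 0 ≤ f x s)
    (hfder : ∀ x s, 0 ≤ s → HasDerivAt (f x) (f' x s) s)
    (hfb : ∀ x s, 0 ≤ s → |f' x s| ≤ c_f * (s + 1) ^ (α - 1))
    (hm₀reg : ContDiff ℝ 2 m₀) (hm₀per : ZPeriodic m₀) (hm₀pos : ∀ x, 0 < m₀ x)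
    (hm₀int : (∫ x in cube N, m₀ x) = 1)
    (huTreg : ContDiff ℝ 2 uT) (huTper : ZPeriodic uT)
    (h2 : 2 < γ') (hle : γ' ≤ (N : ℝ) + 2) (hsub : α < γ' / N)
    (us ms : ℝ → RN N → ℝ → ℝ)
    (hsol : ∀ η ∈ Ioc (0:ℝ) 1,
      ClassicalSol N T (Hpen (Leg H) η) (fun x _ mv => -f x mv) m₀ uT (us η) (ms η) ∧
      MinimisesE N T α γ' m₀ (Lpen (Leg H) η) (Fint f) uT (ms η)
        (fun x t => (-(ms η x t)) • grad (Hpen (Leg H) η) (grad (fun y => us η y t) x))) :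
    ∀ p : ℝ, 1 ≤ p → (γ' < (N : ℝ) + 2 → p < ((N : ℝ) + 2) / ((N : ℝ) + 2 - γ')) →
      ∃ C > (0:ℝ), ∀ η ∈ Ioc (0:ℝ) 1,
        IntegrableOn (fun q : RN N × ℝ => ms η q.1 q.2 ^ p) (QQ N T) ∧
        (intQ N T (fun x t => ms η x t ^ p)) ^ (1 / p) ≤ C := by
  intro p hp hp'
  have hN1 : (1 : ℝ) ≤ N := by exact_mod_cast hN
  have hL : Continuous (Leg H) := (convexOn_Leg (bddAbove_dotp_sub hCH hγ
    fun p => (hHgrowth p).1)).locallyLipschitz.continuous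
  have hcl : ∀ η ∈ Ioc (0 : ℝ) 1, FPClassical N T (ms η)
      fun x t => grad (Hpen (Leg H) η) (grad (fun y => us η y t) x) := fun η hη =>
    (hsol η hη).1.fpClassical (differentiable_grad_Hpen hHconv (hHreg.of_le (by norm_num)) hCH hγ
      (fun p => (hHgrowth p).1) hCL h2 (fun q => (hLgrowth q).1) hη.1.le) (hsol η hη).2.1.nonneg
  obtain ⟨C₁, hC₁, hmin⟩ := exists_energy_le_of_minimisesE (uT := uT) hT.le hα (by linarith) hCL hL
    (fun q => (hLgrowth q).1) hfcont hfnn hfder hfb hm₀reg hm₀per hm₀pos huTreg.continuous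
  obtain ⟨E₀, hE₀⟩ := FPClassical.exists_energy_bound hN hT.le h2 hα.le hsub hC₁ m₀
    fun x => (hm₀pos x).le
  obtain ⟨r, hr2, hrγ, hrN, hpr⟩ := exists_exponent hN1 h2 hle hp hp'
  obtain ⟨C, hC⟩ := FPClassical.exists_rpow_bound (E₀ := T * (∫ x in cube N, (m₀ x + 1)) + E₀)
    hN hT hr2 hrN m₀ fun x => (hm₀pos x).le
  refine ⟨max C 0 ^ (1 / p) + 1, by positivity, fun η hη => ?_⟩
  have h := hcl η hη
  have h₀ := (hsol η hη).1.init
  have hi : IntegrableOn (fun q : RN N × ℝ => ms η q.1 q.2 ^ p) (QQ N T) :=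
    (h.cont_m.rpow_const fun _ _ => Or.inr (by linarith)).integrableOn_QQ
  refine ⟨hi, le_add_of_le_of_nonneg (Real.rpow_le_rpow (intQ_nonneg fun x t _ =>
    Real.rpow_nonneg (h.nonneg x t) p) (le_max_of_le_left ?_) (by positivity)) zero_le_one⟩
  have hE := h.intQ_energy_le hT.le (by linarith) hrγ
  simp only [h₀] at hE
  refine le_trans (intQ_mono hi (h.cont_rpow _).integrableOn_QQ fun x _ t _ => ?_)
    (hC _ _ h h₀ (hE.trans (add_le_add_right (hE₀ _ _ h h₀ (hmin η hη _ _ h h₀ (hsol η hη).2)) _)))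
  exact (Real.rpow_le_rpow (h.nonneg x t) (by linarith) (by linarith)).trans
    (Real.rpow_le_rpow_of_exponent_le (h.one_le_add_one x t) hpr)
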